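/- arXiv:2506.13602 — 2 statements merged into one kernel-verified Lean document; each statement's English description precedes it below -/
import Mathlib

section
/- Let A be a brick-finite finite-dimensional algebra. The following are equivalent: (1) A is brick-directed; (2) K_0(proj A)_ℝ admits a consistent sequence; (3) K_0(proj A)_ℝ admits a weakly consistent sequence. -/
open Function

def IsBrick (A : Type) [Ring A] (M : ModuleCat.{0} A) : Prop :=
  Nontrivial M ∧ ∀ f : M →ₗ[A] M, f ≠ 0 → Function.Bijective f

/-- `mod A` contains a brick-cycle: a sequence of nonzero non-invertible homomorphisms
`X₀ → X₁ → ⋯ → X_m` (`m ≥ 1`) between bricks with `X₀ ≅ X_m`. -/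
def HasBrickCycle (A : Type) [Ring A] : Prop :=
  ∃ (m : ℕ) (X : ℕ → ModuleCat.{0} A) (f : ∀ i : ℕ, X i →ₗ[A] X (i + 1)),
    1 ≤ m ∧ (∀ i ≤ m, Module.Finite A (X i) ∧ IsBrick A (X i)) ∧
    (∀ i < m, f i ≠ 0 ∧ ¬ Function.Bijective (f i)) ∧
    Nonempty (X 0 ≃ₗ[A] X m)

/-- `A` is brick-directed if `mod A` contains no brick-cycle. -/
def BrickDirected (A : Type) [Ring A] : Prop := ¬ HasBrickCycle A

/-- `A` is brick-finite: up to isomorphism there are only finitely many bricks. -/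
def BrickFinite (A : Type) [Ring A] : Prop :=
  ∃ (n : ℕ) (B : Fin n → ModuleCat.{0} A),
    ∀ X : ModuleCat.{0} A, Module.Finite A X → IsBrick A X →
      ∃ i, Nonempty (X ≃ₗ[A] B i)

/-- An element `θ` of `K₀(proj A)_ℝ`, encoded via the Euler pairing as the additive
isomorphism-invariant real-valued function `M ↦ θ([M])` on `mod A`. -/
structure AddInvariant (A : Type) [Ring A] where
  val : ModuleCat.{0} A → ℝ
  iso_inv : ∀ (M N : ModuleCat.{0} A), (M ≃ₗ[A] N) → val M = val N
  add_of_exact : ∀ (L M N : ModuleCat.{0} A) (i : L →ₗ[A] M) (p : M →ₗ[A] N),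
    Module.Finite A M → Function.Injective i → Function.Surjective p →
    Function.Exact i p → val M = val L + val N

/-- `M` is `θ`-semistable: `θ([M]) = 0` and `θ([N]) ≥ 0` for every quotient `N` of `M`. -/
def AddInvariant.Semistable {A : Type} [Ring A] (θ : AddInvariant A)
    (M : ModuleCat.{0} A) : Prop :=
  θ.val M = 0 ∧ ∀ (N : ModuleCat.{0} A) (p : M →ₗ[A] N), Function.Surjective p → 0 ≤ θ.val N

/-- `M` is `θ`-stable: `θ`-semistable and `θ([N]) > 0` for every nonzero proper
quotient `N` of `M`. -/
def AddInvariant.Stable {A : Type} [Ring A] (θ : AddInvariant A)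
    (M : ModuleCat.{0} A) : Prop :=
  θ.Semistable M ∧ ∀ (N : ModuleCat.{0} A) (p : M →ₗ[A] N),
    Function.Surjective p → ¬ Function.Injective p → Nontrivial N → 0 < θ.val N

/-- A (weakly) consistent sequence `{θ_j}_{j ∈ J}` in `K₀(proj A)_ℝ`: for some indexing
`{X_j}_{j ∈ J}` of the isomorphism classes of bricks by the totally ordered set `J`,
`θ_i([X_j]) < 0` for `i < j`, `θ_i([X_j]) > 0` (respectively `≥ 0`) for `i > j`,
and `X_i` is `θ_i`-stable. -/
def IsConsistentSequence (A : Type) [Ring A] (strict : Bool)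
    (J : Type) (r : J → J → Prop) (θ : J → AddInvariant A) : Prop :=
  IsStrictTotalOrder J r ∧
  ∃ X : J → ModuleCat.{0} A,
    (∀ j, Module.Finite A (X j) ∧ IsBrick A (X j)) ∧
    (∀ i j, Nonempty (X i ≃ₗ[A] X j) → i = j) ∧
    (∀ Y : ModuleCat.{0} A, Module.Finite A Y → IsBrick A Y →
      ∃ j, Nonempty (Y ≃ₗ[A] X j)) ∧
    (∀ i j, r i j → (θ i).val (X j) < 0) ∧
    (∀ i j, r j i → (if strict then 0 < (θ i).val (X j) else 0 ≤ (θ i).val (X j))) ∧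
    (∀ i, (θ i).Stable (X i))

set_option linter.unusedSectionVars false

section Basics

variable {A : Type} [Ring A]
variable {L M N : Type} [AddCommGroup L] [Module A L] [AddCommGroup M] [Module A M]
  [AddCommGroup N] [Module A N]

/-- Factoring a map through a surjection. -/
theorem factor_surj (p : M →ₗ[A] N) (hp : Surjective p) (g : M →ₗ[A] L)
    (h : ∀ x, p x = 0 → g x = 0) : ∃ g' : N →ₗ[A] L, ∀ x, g' (p x) = g x := by
  refine ⟨(LinearMap.ker p).liftQ g (fun x hx => h x (by simpa using hx)) ∘ₗ
    (p.quotKerEquivOfSurjective hp).symm.toLinearMap, fun x => ?_⟩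
  have : (p.quotKerEquivOfSurjective hp).symm (p x) = Submodule.Quotient.mk x := by
    rw [LinearEquiv.symm_apply_eq]
    rfl
  rw [LinearMap.comp_apply, LinearEquiv.coe_coe, this]
  exact Submodule.liftQ_apply _ _ _

/-- The length as a natural number. -/
noncomputable def len (A M : Type) [Ring A] [AddCommGroup M] [Module A M] : ℕ :=
  (Module.length A M).toNat

variable [IsArtinianRing A] [IsNoetherianRing A]

theorem coe_len [Module.Finite A M] : ((len A M : ℕ) : ℕ∞) = Module.length A M :=
  ENat.natCast_toNat Module.length_ne_top

theorem len_exact [Module.Finite A M] (i : L →ₗ[A] M) (p : M →ₗ[A] N)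
    (hi : Injective i) (hp : Surjective p) (hip : Function.Exact i p) :
    len A M = len A L + len A N := by
  have : Module.Finite A L := Module.Finite.of_injective i hi
  have : Module.Finite A N := Module.Finite.of_surjective p hp
  have := Module.length_eq_add_of_exact i p hi hp hip
  rw [← coe_len, ← coe_len, ← coe_len] at this
  exact_mod_cast this

theorem len_pos [Module.Finite A M] [Nontrivial M] : 0 < len A M := by
  have := Module.length_pos (R := A) (M := M)
  rw [← coe_len] at this
  exact_mod_cast this

theorem len_le_of_surj [Module.Finite A M] (p : M →ₗ[A] N) (hp : Surjective p) :
    len A N ≤ len A M := by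
  have := len_exact (LinearMap.ker p).subtype p (Submodule.subtype_injective _) hp
    (LinearMap.exact_subtype_ker_map p)
  omega

theorem len_lt_of_surj [Module.Finite A M] (p : M →ₗ[A] N) (hp : Surjective p)
    (hn : ¬ Injective p) : len A N < len A M := by
  have := len_exact (LinearMap.ker p).subtype p (Submodule.subtype_injective _) hp
    (LinearMap.exact_subtype_ker_map p)
  have h2 : Nontrivial (LinearMap.ker p) := by
    rw [Submodule.nontrivial_iff_ne_bot]
    intro h
    exact hn (LinearMap.ker_eq_bot.mp h)
  have := len_pos (A := A) (M := LinearMap.ker p)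
  omega

theorem len_lt_of_inj [Module.Finite A M] (i : L →ₗ[A] M) (hi : Injective i)
    (hn : ¬ Surjective i) : len A L < len A M := by
  have := len_exact i (LinearMap.range i).mkQ hi (Submodule.mkQ_surjective _)
    (LinearMap.exact_map_mkQ_range i)
  have h2 : Nontrivial (M ⧸ LinearMap.range i) := by
    rw [Submodule.Quotient.nontrivial_iff]
    intro h
    exact hn (LinearMap.range_eq_top.mp h)
  have := len_pos (A := A) (M := M ⧸ LinearMap.range i)
  omega

/-- Every nonzero finite module has a brick which is both a quotient and a submodule. -/
theorem exists_brick : ∀ (n : ℕ) (M : Type) [AddCommGroup M] [Module A M] [Module.Finite A M]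
    [Nontrivial M], len A M = n → ∃ B : ModuleCat.{0} A, Module.Finite A B ∧ IsBrick A B ∧
      (∃ p : M →ₗ[A] B, Surjective p) ∧ ∃ i : B →ₗ[A] M, Injective i := by
  intro n
  induction n using Nat.strong_induction_on with
  | _ n ih =>
  intro M _ _ _ _ hn
  by_cases hb : IsBrick A (ModuleCat.of A M)
  · exact ⟨ModuleCat.of A M, ‹_›, hb, ⟨LinearMap.id, surjective_id⟩, ⟨LinearMap.id, injective_id⟩⟩
  · have : ∃ f : M →ₗ[A] M, f ≠ 0 ∧ ¬ Bijective f := by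
      by_contra hcon
      push Not at hcon
      exact hb ⟨‹_›, hcon⟩
    obtain ⟨f, hf0, hfb⟩ := this
    have hni : ¬ Injective f := fun h => hfb (IsArtinian.bijective_of_injective_endomorphism f h)
    have hlt : len A (LinearMap.range f) < n := by
      rw [← hn]
      refine len_lt_of_surj f.rangeRestrict f.surjective_rangeRestrict ?_
      intro h
      apply hni
      intro x y hxy
      exact h (Subtype.ext hxy)
    have : Nontrivial (LinearMap.range f) := by
      rw [Submodule.nontrivial_iff_ne_bot]
      intro h
      exact hf0 (LinearMap.range_eq_bot.mp h)
    obtain ⟨B, hB1, hB2, ⟨p, hp⟩, ⟨i, hi⟩⟩ := ih _ hlt (LinearMap.range f) rfl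
    exact ⟨B, hB1, hB2, ⟨p ∘ₗ f.rangeRestrict, hp.comp f.surjective_rangeRestrict⟩,
      ⟨(LinearMap.range f).subtype ∘ₗ i, (Submodule.subtype_injective _).comp hi⟩⟩

end Basics

/-- The setting: a finite directed list of all bricks. -/
structure BSetup (A : Type) [Ring A] {m : ℕ} (X : Fin m → ModuleCat.{0} A) : Prop where
  fin : ∀ a, Module.Finite A (X a)
  brick : ∀ a, IsBrick A (X a)
  all : ∀ Y : ModuleCat.{0} A, Module.Finite A Y → IsBrick A Y → ∃ a, Nonempty (Y ≃ₗ[A] X a)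
  dir : ∀ (a b : Fin m) (f : X a →ₗ[A] X b), f ≠ 0 → b ≤ a

section Torsion

variable {A : Type} [Ring A] {m : ℕ}

/-- The torsion class generated by the bricks of index `< n`. -/
def Tor (X : Fin m → ModuleCat.{0} A) (n : ℕ) (M : Type) [AddCommGroup M] [Module A M] : Prop :=
  ∀ (a : Fin m) (f : M →ₗ[A] X a), f ≠ 0 → a.val < n

/-- The torsion-free class generated by the bricks of index `≥ n`. -/
def Fre (X : Fin m → ModuleCat.{0} A) (n : ℕ) (M : Type) [AddCommGroup M] [Module A M] : Prop :=
  ∀ (a : Fin m) (f : X a →ₗ[A] M), f ≠ 0 → n ≤ a.val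

variable {X : Fin m → ModuleCat.{0} A} {n : ℕ}
variable {L M N : Type} [AddCommGroup L] [Module A L] [AddCommGroup M] [Module A M]
  [AddCommGroup N] [Module A N]

theorem Tor.mono (h : Tor X n M) {n' : ℕ} (hn : n ≤ n') : Tor X n' M :=
  fun a f hf => (h a f hf).trans_le hn

theorem Fre.mono {n' : ℕ} (h : Fre X n' M) (hn : n ≤ n') : Fre X n M :=
  fun a f hf => hn.trans (h a f hf)

theorem Tor.of_surj (h : Tor X n M) (p : M →ₗ[A] N) (hp : Surjective p) : Tor X n N := by
  intro a f hf
  refine h a (f ∘ₗ p) ?_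
  intro h0
  apply hf
  ext y
  obtain ⟨x, rfl⟩ := hp y
  exact LinearMap.congr_fun h0 x

theorem Fre.of_inj (h : Fre X n M) (i : L →ₗ[A] M) (hi : Injective i) : Fre X n L := by
  intro a f hf
  refine h a (i ∘ₗ f) ?_
  intro h0
  apply hf
  ext y
  apply hi
  simpa using LinearMap.congr_fun h0 y

theorem Tor.ext (hL : Tor X n L) (hN : Tor X n N) (i : L →ₗ[A] M) (p : M →ₗ[A] N)
    (hp : Surjective p) (hip : ∀ x, p x = 0 → ∃ y, i y = x) : Tor X n M := by
  intro a f hf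
  by_cases h0 : f ∘ₗ i = 0
  · obtain ⟨g, hg⟩ := factor_surj p hp f (by
      intro x hx
      obtain ⟨y, rfl⟩ := hip x hx
      exact LinearMap.congr_fun h0 y)
    refine hN a g ?_
    rintro rfl
    apply hf
    ext x
    simpa using (hg x).symm
  · exact hL a _ h0

theorem Tor.prod (hL : Tor X n L) (hN : Tor X n N) : Tor X n (L × N) :=
  Tor.ext hL hN (LinearMap.inl A L N) (LinearMap.snd A L N) LinearMap.snd_surjective
    (fun x hx => ⟨x.1, by ext <;> simp_all⟩)

theorem Fre.prod (hL : Fre X n L) (hN : Fre X n N) : Fre X n (L × N) := by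
  intro a f hf
  by_cases h1 : LinearMap.fst A L N ∘ₗ f = 0
  · by_cases h2 : LinearMap.snd A L N ∘ₗ f = 0
    · exfalso
      apply hf
      ext x
      · exact LinearMap.congr_fun h1 x
      · exact LinearMap.congr_fun h2 x
    · exact hN a _ h2
  · exact hL a _ h1

theorem Tor.pi {r : ℕ} (hL : Tor X n L) : Tor X n (Fin r → L) := by
  intro a f hf
  by_contra hcon
  apply hf
  apply LinearMap.pi_ext'
  intro i
  by_contra h
  exact hcon (hL a _ h)

theorem Tor.of_subsingleton [Subsingleton M] : Tor X n M := by
  intro a f hf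
  exact absurd (by ext x; rw [Subsingleton.elim x 0]; simp) hf

theorem BSetup.tor (S : BSetup A X) (a : Fin m) (h : a.val < n) : Tor X n (X a) := by
  intro b f hf
  have := S.dir a b f hf
  omega

theorem BSetup.fre (S : BSetup A X) (a : Fin m) (h : n ≤ a.val) : Fre X n (X a) := by
  intro b f hf
  have := S.dir b a f hf
  omega

/-- Proper quotients of the brick `X a` lie in the torsion class below `a`. -/
theorem BSetup.tor_quot (S : BSetup A X) (a : Fin m) (p : X a →ₗ[A] N) (hp : Surjective p)
    (hn : ¬ Injective p) : Tor X a.val N := by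
  intro b f hf
  have h0 : f ∘ₗ p ≠ 0 := by
    intro h0
    apply hf
    ext y
    obtain ⟨x, rfl⟩ := hp y
    exact LinearMap.congr_fun h0 x
  have hle := S.dir a b _ h0
  rcases lt_or_eq_of_le hle with h | h
  · exact h
  · subst h
    exfalso
    have := ((S.brick b).2 _ h0).1
    rw [LinearMap.coe_comp] at this
    exact hn this.of_comp

variable [IsArtinianRing A] [IsNoetherianRing A]

theorem BSetup.exists_brick (S : BSetup A X) (M : Type) [AddCommGroup M] [Module A M]
    [Module.Finite A M] [Nontrivial M] : ∃ a, (∃ p : M →ₗ[A] X a, Surjective p) ∧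
      ∃ i : X a →ₗ[A] M, Injective i := by
  obtain ⟨B, h1, h2, ⟨p, hp⟩, ⟨i, hi⟩⟩ := _root_.exists_brick (A := A) _ M rfl
  obtain ⟨a, ⟨e⟩⟩ := S.all B h1 h2
  exact ⟨a, ⟨e.toLinearMap ∘ₗ p, e.surjective.comp hp⟩,
    ⟨i ∘ₗ e.symm.toLinearMap, hi.comp e.symm.injective⟩⟩

theorem BSetup.ne_zero_surj (S : BSetup A X) {a : Fin m} (p : M →ₗ[A] X a) (hp : Surjective p) :
    p ≠ 0 := by
  rintro rfl
  obtain ⟨h, -⟩ := S.brick a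
  obtain ⟨x, hx⟩ := exists_ne (0 : X a)
  obtain ⟨y, hy⟩ := hp x
  exact hx (by simpa using hy.symm)

theorem BSetup.ne_zero_inj (S : BSetup A X) {a : Fin m} (p : X a →ₗ[A] M) (hp : Injective p) :
    p ≠ 0 := by
  rintro rfl
  obtain ⟨h, -⟩ := S.brick a
  obtain ⟨x, hx⟩ := exists_ne (0 : X a)
  exact hx (hp (by simp))

theorem BSetup.hom_zero (S : BSetup A X) [Module.Finite A M] (hM : Tor X n M) (hN : Fre X n N)
    (f : M →ₗ[A] N) : f = 0 := by
  by_contra hf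
  have : Nontrivial (LinearMap.range f) := by
    rw [Submodule.nontrivial_iff_ne_bot]
    intro h
    exact hf (LinearMap.range_eq_bot.mp h)
  obtain ⟨a, ⟨p, hp⟩, ⟨i, hi⟩⟩ := S.exists_brick (LinearMap.range f)
  have h1 := (hM.of_surj f.rangeRestrict f.surjective_rangeRestrict) a p (S.ne_zero_surj p hp)
  have h2 := (hN.of_inj (LinearMap.range f).subtype (Submodule.subtype_injective _)) a i
    (S.ne_zero_inj i hi)
  omega

/-- Existence of the torsion submodule. -/
theorem BSetup.exists_torsion (S : BSetup A X) (n : ℕ) (M : Type) [AddCommGroup M] [Module A M]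
    [Module.Finite A M] : ∃ t : Submodule A M, Tor X n t ∧ Fre X n (M ⧸ t) := by
  obtain ⟨t, ht, hmax⟩ := set_has_maximal_iff_noetherian.mpr (inferInstance : IsNoetherian A M)
    {t : Submodule A M | Tor X n t} ⟨⊥, Tor.of_subsingleton⟩
  refine ⟨t, ht, ?_⟩
  intro a f hf
  by_contra hlt
  push Not at hlt
  set R := LinearMap.range f with hR
  have hRT : Tor X n R := (S.tor a hlt).of_surj f.rangeRestrict f.surjective_rangeRestrict
  set t' : Submodule A M := R.comap t.mkQ with ht'
  have hle : t ≤ t' := by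
    intro x hx
    have : t.mkQ x = 0 := by simpa using hx
    rw [ht', Submodule.mem_comap, this]
    exact R.zero_mem
  have hT' : Tor X n t' := by
    refine Tor.ext ht hRT (Submodule.inclusion hle)
      ((t.mkQ ∘ₗ t'.subtype).codRestrict R (fun x => x.2)) ?_ ?_
    · rintro ⟨y, hy⟩
      obtain ⟨x, rfl⟩ := t.mkQ_surjective y
      exact ⟨⟨x, hy⟩, rfl⟩
    · rintro ⟨x, hx⟩ h0
      have h1 : t.mkQ x = 0 := congrArg Subtype.val h0
      have h2 : x ∈ t := by simpa using h1
      exact ⟨⟨x, h2⟩, rfl⟩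
  apply hmax t' hT'
  refine lt_of_le_of_ne hle ?_
  intro heq
  apply hf
  ext x
  obtain ⟨y, hy⟩ := t.mkQ_surjective (f x)
  have : y ∈ t' := by
    rw [ht', Submodule.mem_comap, hy]
    exact LinearMap.mem_range_self f x
  rw [← heq] at this
  rw [← hy]
  simpa using this

end Torsion
section Pushout

variable {A : Type} [Ring A]
variable {P V E : Type} [AddCommGroup P] [Module A P] [AddCommGroup V] [Module A V]
  [AddCommGroup E] [Module A E]

/-- Pushout of the extension `ker s → P → E` along `v : ker s → V`. -/
theorem exists_pushout (s : P →ₗ[A] E) (v : LinearMap.ker s →ₗ[A] V) :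
    ∃ (Y : ModuleCat.{0} A) (j : V →ₗ[A] Y) (l : P →ₗ[A] Y) (π : Y →ₗ[A] E),
      (∀ y, ∃ x p, y = j x + l p) ∧ (∀ w : LinearMap.ker s, l w = j (v w)) ∧ Injective j ∧
      (∀ p, π (l p) = s p) ∧ (∀ x, π (j x) = 0) ∧ (∀ y, π y = 0 → ∃ x, j x = y) ∧
      ∀ (M : Type) [AddCommGroup M] [Module A M] (g : P →ₗ[A] M) (h : V →ₗ[A] M),
        (∀ w : LinearMap.ker s, g w = h (v w)) →
          ∃ q : Y →ₗ[A] M, (∀ p, q (l p) = g p) ∧ ∀ x, q (j x) = h x := by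
  set W : Submodule A (V × P) := LinearMap.range (v.prod (-(LinearMap.ker s).subtype)) with hW
  have memW : ∀ z : V × P, z ∈ W ↔ ∃ w : LinearMap.ker s, v w = z.1 ∧ -(w : P) = z.2 := by
    intro z
    rw [hW, LinearMap.mem_range]
    constructor
    · rintro ⟨w, rfl⟩
      exact ⟨w, rfl, rfl⟩
    · rintro ⟨w, h1, h2⟩
      exact ⟨w, Prod.ext h1 h2⟩
  have hmk : ∀ z : V × P, W.mkQ z = 0 ↔ ∃ w : LinearMap.ker s, v w = z.1 ∧ -(w : P) = z.2 := by
    intro z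
    rw [← memW, Submodule.mkQ_apply, Submodule.Quotient.mk_eq_zero]
  obtain ⟨π, hπ⟩ := factor_surj W.mkQ W.mkQ_surjective (s ∘ₗ LinearMap.snd A V P) (by
    intro z hz
    obtain ⟨w, h1, h2⟩ := (hmk z).1 hz
    have : s (w : P) = 0 := w.2
    simp [← h2, this])
  refine ⟨ModuleCat.of A ((V × P) ⧸ W), W.mkQ ∘ₗ LinearMap.inl A V P, W.mkQ ∘ₗ LinearMap.inr A V P,
    π, ?_, ?_, ?_, ?_, ?_, ?_, ?_⟩
  · intro y
    obtain ⟨⟨x, p⟩, rfl⟩ := W.mkQ_surjective y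
    refine ⟨x, p, ?_⟩
    rw [LinearMap.comp_apply, LinearMap.comp_apply]
    erw [← map_add]
    simp
  · intro w
    rw [LinearMap.comp_apply, LinearMap.comp_apply, ← sub_eq_zero]
    erw [← map_sub]
    rw [hmk]
    exact ⟨-w, by simp, by simp⟩
  · rw [injective_iff_map_eq_zero]
    intro x hx
    obtain ⟨w, h1, h2⟩ := (hmk _).1 hx
    have : w = 0 := by
      apply Subtype.ext
      simpa using h2
    simpa [this] using h1.symm
  · intro p
    have := hπ (0, p)
    simpa using this
  · intro x
    have := hπ (x, 0)
    simpa using this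
  · intro y hy
    obtain ⟨⟨x, p⟩, rfl⟩ := W.mkQ_surjective y
    have h1 : s p = 0 := by
      have := hπ (x, p)
      rw [this] at hy
      simpa using hy
    refine ⟨x + v ⟨p, h1⟩, ?_⟩
    rw [LinearMap.comp_apply, ← sub_eq_zero]
    erw [← map_sub]
    rw [hmk]
    exact ⟨⟨p, h1⟩, by simp, by simp⟩
  · intro M _ _ g h hgh
    obtain ⟨q, hq⟩ := factor_surj W.mkQ W.mkQ_surjective
      (h ∘ₗ LinearMap.fst A V P + g ∘ₗ LinearMap.snd A V P) (by
        intro z hz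
        obtain ⟨w, h1, h2⟩ := (hmk z).1 hz
        simp [← h1, ← h2, hgh])
    refine ⟨q, fun p => ?_, fun x => ?_⟩
    · have := hq (0, p)
      simpa using this
    · have := hq (x, 0)
      simpa using this

end Pushout

section Cat

variable {A : Type} [Ring A] {m : ℕ} {X : Fin m → ModuleCat.{0} A}
variable [IsArtinianRing A] [IsNoetherianRing A]

theorem BSetup.split_aux (S : BSetup A X) (a : Fin m) {J T : Type} [AddCommGroup J] [Module A J]
    [AddCommGroup T] [Module A T] [Module.Finite A J] (i : X a →ₗ[A] J) (p : J →ₗ[A] T)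
    (hi : Injective i) (hp : Surjective p) (hip : ∀ x, p x = 0 → ∃ y, i y = x)
    (hip' : ∀ y, p (i y) = 0) (hJ : Fre X a.val J) (hT : Tor X a.val T) : p = 0 := by
  have hTfin : Module.Finite A T := Module.Finite.of_surjective p hp
  have hJ' : Tor X (a.val + 1) J :=
    Tor.ext (S.tor a (Nat.lt_succ_self _)) (hT.mono (Nat.le_succ _)) i p hp hip
  have : Nontrivial J := by
    have := (S.brick a).1
    exact hi.nontrivial
  obtain ⟨b, ⟨q, hq⟩, ⟨j, hj⟩⟩ := S.exists_brick J
  have h1 := hJ' b q (S.ne_zero_surj q hq)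
  have h2 := hJ b j (S.ne_zero_inj j hj)
  have hab : a = b := by
    apply Fin.ext
    omega
  subst hab
  have hne : q ∘ₗ i ≠ 0 := by
    intro h0
    obtain ⟨g, hg⟩ := factor_surj p hp q (by
      intro x hx
      obtain ⟨y, rfl⟩ := hip x hx
      exact LinearMap.congr_fun h0 y)
    have hg0 : g ≠ 0 := by
      rintro rfl
      apply S.ne_zero_surj q hq
      ext x
      simpa using (hg x).symm
    exact absurd (hT a g hg0) (lt_irrefl _)
  set e := LinearEquiv.ofBijective (q ∘ₗ i) ((S.brick a).2 _ hne) with he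
  have hez : ∀ x, e x = q (i x) := fun x => rfl
  obtain ⟨g, hg⟩ := factor_surj p hp (LinearMap.id - i ∘ₗ e.symm.toLinearMap ∘ₗ q) (by
    intro x hx
    obtain ⟨y, rfl⟩ := hip x hx
    simp [← hez])
  have hg0 := S.hom_zero hT hJ g
  ext x
  have h3 := hg x
  rw [hg0] at h3
  have h4 : x = i (e.symm (q x)) := by
    have : (0 : J) = x - i (e.symm (q x)) := by simpa using h3
    exact (sub_eq_zero.1 this.symm)
  rw [h4, hip']
  rfl

theorem BSetup.fre_quot (S : BSetup A X) (a : Fin m) {N : Type} [AddCommGroup N] [Module A N]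
    [Module.Finite A N] (i : X a →ₗ[A] N) (hi : Injective i) (hN : Fre X a.val N) :
    Fre X a.val (N ⧸ LinearMap.range i) := by
  set t := LinearMap.range i with ht
  intro b f hf
  by_contra hlt
  push Not at hlt
  set R := LinearMap.range f with hR
  have hRT : Tor X a.val R := (S.tor b hlt).of_surj f.rangeRestrict f.surjective_rangeRestrict
  set t' : Submodule A N := R.comap t.mkQ with ht'
  have hle : ∀ x, i x ∈ t' := by
    intro x
    have : t.mkQ (i x) = 0 := by
      rw [Submodule.mkQ_apply, Submodule.Quotient.mk_eq_zero]
      exact LinearMap.mem_range_self i x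
    rw [ht', Submodule.mem_comap, this]
    exact R.zero_mem
  have key := S.split_aux a (i.codRestrict t' hle)
    ((t.mkQ ∘ₗ t'.subtype).codRestrict R (fun x => x.2)) ?_ ?_ ?_ ?_
    (hN.of_inj t'.subtype (Submodule.subtype_injective _)) hRT
  · apply hf
    ext x
    obtain ⟨y, hy⟩ := t.mkQ_surjective (f x)
    have hy' : y ∈ t' := by
      rw [ht', Submodule.mem_comap, hy]
      exact LinearMap.mem_range_self f x
    have := congrArg Subtype.val (LinearMap.congr_fun key ⟨y, hy'⟩)
    rw [← hy]
    exact this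
  · intro x y hxy
    exact hi (congrArg Subtype.val hxy)
  · rintro ⟨y, hy⟩
    obtain ⟨x, rfl⟩ := t.mkQ_surjective y
    exact ⟨⟨x, hy⟩, rfl⟩
  · rintro ⟨x, hx⟩ h0
    have h1 : t.mkQ x = 0 := congrArg Subtype.val h0
    rw [Submodule.mkQ_apply, Submodule.Quotient.mk_eq_zero] at h1
    obtain ⟨y, rfl⟩ := h1
    exact ⟨y, rfl⟩
  · intro y
    apply Subtype.ext
    change t.mkQ (i y) = 0
    rw [Submodule.mkQ_apply, Submodule.Quotient.mk_eq_zero]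
    exact LinearMap.mem_range_self i y

theorem BSetup.exists_sub (S : BSetup A X) (a : Fin m) {E : Type} [AddCommGroup E] [Module A E]
    [Module.Finite A E] [Nontrivial E] (hT : Tor X (a.val + 1) E) (hF : Fre X a.val E) :
    ∃ i : X a →ₗ[A] E, Injective i := by
  obtain ⟨b, ⟨q, hq⟩, ⟨j, hj⟩⟩ := S.exists_brick E
  have h1 := hT b q (S.ne_zero_surj q hq)
  have h2 := hF b j (S.ne_zero_inj j hj)
  have hab : a = b := by
    apply Fin.ext
    omega
  subst hab
  exact ⟨j, hj⟩

theorem BSetup.len_quot (S : BSetup A X) (a : Fin m) {E : Type} [AddCommGroup E] [Module A E]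
    [Module.Finite A E] (i : X a →ₗ[A] E) (hi : Injective i) :
    len A E = len A (X a) + len A (E ⧸ LinearMap.range i) ∧
      len A (E ⧸ LinearMap.range i) < len A E := by
  have := S.fin a
  have := (S.brick a).1
  have h1 := len_exact i (LinearMap.range i).mkQ hi (Submodule.mkQ_surjective _)
    (LinearMap.exact_map_mkQ_range i)
  have := len_pos (A := A) (M := X a)
  omega

theorem BSetup.ker_tor (S : BSetup A X) (a : Fin m) : ∀ (d : ℕ) (E N : Type) [AddCommGroup E]
    [Module A E] [Module.Finite A E] [AddCommGroup N] [Module A N] [Module.Finite A N]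
    (q : E →ₗ[A] N), len A E = d → Tor X (a.val + 1) E → Fre X a.val E → Fre X a.val N →
      Tor X (a.val + 1) (LinearMap.ker q) := by
  intro d
  induction d using Nat.strong_induction_on with
  | _ d ih =>
  intro E N _ _ _ _ _ _ q hd hT hF hN
  rcases subsingleton_or_nontrivial E with hE | hE
  · exact Tor.of_subsingleton
  obtain ⟨i, hi⟩ := S.exists_sub a hT hF
  have hlen := (S.len_quot a i hi).2
  set R := LinearMap.range i with hR
  have hT2 : Tor X (a.val + 1) (E ⧸ R) := hT.of_surj R.mkQ R.mkQ_surjective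
  have hF2 : Fre X a.val (E ⧸ R) := S.fre_quot a i hi hF
  have hmk : ∀ x, R.mkQ x = 0 ↔ ∃ y, i y = x := by
    intro x
    rw [Submodule.mkQ_apply, Submodule.Quotient.mk_eq_zero, hR, LinearMap.mem_range]
  by_cases h0 : q ∘ₗ i = 0
  · have h0' : ∀ x, q (i x) = 0 := fun x => LinearMap.congr_fun h0 x
    obtain ⟨q', hq'⟩ := factor_surj R.mkQ R.mkQ_surjective q (by
      intro x hx
      obtain ⟨y, rfl⟩ := (hmk x).1 hx
      exact h0' y)
    have hK := ih _ (hd ▸ hlen) (E ⧸ R) N q' rfl hT2 hF2 hN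
    refine Tor.ext (S.tor a (Nat.lt_succ_self _)) hK (i.codRestrict (LinearMap.ker q) h0')
      ((R.mkQ ∘ₗ (LinearMap.ker q).subtype).codRestrict (LinearMap.ker q') (fun x => ?_)) ?_ ?_
    · have : q x.1 = 0 := x.2
      rw [LinearMap.mem_ker, LinearMap.comp_apply, hq']
      exact this
    · rintro ⟨y, hy⟩
      obtain ⟨x, rfl⟩ := R.mkQ_surjective y
      have : q x = 0 := by rw [← hq']; exact hy
      exact ⟨⟨x, this⟩, rfl⟩
    · rintro ⟨x, hx⟩ h1
      have h2 : R.mkQ x = 0 := congrArg Subtype.val h1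
      obtain ⟨y, rfl⟩ := (hmk x).1 h2
      exact ⟨y, rfl⟩
  · have hinj : Injective (q ∘ₗ i) := by
      by_contra hni
      apply h0
      have hTr : Tor X a.val (LinearMap.range (q ∘ₗ i)) := by
        refine S.tor_quot a (q ∘ₗ i).rangeRestrict (LinearMap.surjective_rangeRestrict _) ?_
        intro h
        apply hni
        intro x y hxy
        exact h (Subtype.ext hxy)
      have := S.fin a
      have h3 := S.hom_zero hTr hN (LinearMap.range (q ∘ₗ i)).subtype
      ext x
      exact LinearMap.congr_fun h3 ⟨_, LinearMap.mem_range_self _ x⟩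
    have hFN := S.fre_quot a (q ∘ₗ i) hinj hN
    set R' := LinearMap.range (q ∘ₗ i) with hR'
    have hmk' : ∀ x, R'.mkQ x = 0 ↔ ∃ y, q (i y) = x := by
      intro x
      rw [Submodule.mkQ_apply, Submodule.Quotient.mk_eq_zero, hR', LinearMap.mem_range]
      rfl
    obtain ⟨q', hq'⟩ := factor_surj R.mkQ R.mkQ_surjective (R'.mkQ ∘ₗ q) (by
      intro x hx
      obtain ⟨y, rfl⟩ := (hmk x).1 hx
      exact (hmk' _).2 ⟨y, rfl⟩)
    have hK := ih _ (hd ▸ hlen) (E ⧸ R) (N ⧸ R') q' rfl hT2 hF2 hFN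
    set c : LinearMap.ker q →ₗ[A] LinearMap.ker q' :=
      (R.mkQ ∘ₗ (LinearMap.ker q).subtype).codRestrict (LinearMap.ker q') (fun x => by
        have h5 : q x.1 = 0 := x.2
        rw [LinearMap.mem_ker, LinearMap.comp_apply, hq', LinearMap.comp_apply,
          Submodule.subtype_apply, h5, map_zero]) with hc
    have hcb : Bijective c := by
      constructor
      · rw [injective_iff_map_eq_zero]
        rintro ⟨x, hx⟩ h1
        have h2 : R.mkQ x = 0 := congrArg Subtype.val h1
        obtain ⟨y, rfl⟩ := (hmk x).1 h2
        have h3 : (q ∘ₗ i) y = (q ∘ₗ i) 0 := by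
          rw [map_zero]
          exact hx
        have h4 := hinj h3
        subst h4
        apply Subtype.ext
        simp
      · rintro ⟨y, hy⟩
        obtain ⟨x, rfl⟩ := R.mkQ_surjective y
        have h1 : R'.mkQ (q x) = 0 := by
          have := hq' x
          rw [LinearMap.comp_apply] at this
          rw [← this]
          exact hy
        obtain ⟨z, hz⟩ := (hmk' _).1 h1
        refine ⟨⟨x - i z, ?_⟩, ?_⟩
        · rw [LinearMap.mem_ker, map_sub, hz, sub_self]
        · apply Subtype.ext
          change R.mkQ (x - i z) = R.mkQ x
          rw [map_sub, (hmk (i z)).2 ⟨z, rfl⟩, sub_zero]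
    exact hK.of_surj (LinearEquiv.ofBijective c hcb).symm.toLinearMap
      (LinearEquiv.ofBijective c hcb).symm.surjective

/-- In `Tor ∩ Fre`, if `e` is contained in no proper submodule of the torsion class, the
quotient by `e` is in the smaller torsion class. -/
theorem BSetup.min_quot (S : BSetup A X) (a : Fin m) {E : Type} [AddCommGroup E]
    [Module A E] [Module.Finite A E] (hT : Tor X (a.val + 1) E) (hF : Fre X a.val E) (e : E)
    (hmin : ∀ E' : Submodule A E, e ∈ E' → Tor X (a.val + 1) E' → E' = ⊤) :
    Tor X a.val (E ⧸ Submodule.span A {e}) := by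
  intro b f hf
  by_contra hle
  push Not at hle
  have := S.fin b
  have h1 := S.ker_tor a _ E (X b) (f ∘ₗ (Submodule.span A {e}).mkQ) rfl hT hF (S.fre b hle)
  have h2 := hmin _ (by
    have : (Submodule.span A {e}).mkQ e = 0 := by
      rw [Submodule.mkQ_apply, Submodule.Quotient.mk_eq_zero]
      exact Submodule.mem_span_singleton_self e
    rw [LinearMap.mem_ker, LinearMap.comp_apply, this, map_zero]) h1
  apply hf
  ext x
  exact LinearMap.congr_fun (LinearMap.ker_eq_top.1 h2) x

end Cat
section Theta

variable {A : Type} [Ring A]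

theorem AddInvariant.val_sub (θ : AddInvariant A) (M : ModuleCat.{0} A) [Subsingleton M] :
    θ.val M = 0 := by
  have hfin : Module.Finite A M := inferInstance
  have := θ.add_of_exact M M M LinearMap.id LinearMap.id hfin injective_id surjective_id (by
    intro x
    simp [Subsingleton.elim x 0])
  linarith

/-- A functional positive on the torsion class and negative on the torsion-free class. -/
structure GoodTheta {m : ℕ} (X : Fin m → ModuleCat.{0} A) (n : ℕ) (θ : AddInvariant A) : Prop where
  pos : ∀ M : ModuleCat.{0} A, Module.Finite A M → Nontrivial M → Tor X n M → 0 < θ.val M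
  neg : ∀ M : ModuleCat.{0} A, Module.Finite A M → Nontrivial M → Fre X n M → θ.val M < 0
  bound : ∃ c : ℝ, ∀ (M : ModuleCat.{0} A) (e : M), Submodule.span A {e} = ⊤ → -c ≤ θ.val M

/-- `(U, u)` is a left approximation of the regular module. -/
def IsApp {m : ℕ} (X : Fin m → ModuleCat.{0} A) (n : ℕ) (U : ModuleCat.{0} A) (u : U) : Prop :=
  Module.Finite A U ∧ Tor X n U ∧ ∀ (M : Type) [AddCommGroup M] [Module A M],
    Module.Finite A M → Tor X n M → ∀ x : M, ∃ h : U →ₗ[A] M, h u = x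

variable {m : ℕ} {X : Fin m → ModuleCat.{0} A}
variable [IsArtinianRing A] [IsNoetherianRing A]

theorem BSetup.theta_len (S : BSetup A X) (a : Fin m) (θ : AddInvariant A) :
    ∀ (d : ℕ) (E : Type) [AddCommGroup E] [Module A E] [Module.Finite A E], len A E = d →
      Tor X (a.val + 1) E → Fre X a.val E →
      θ.val (ModuleCat.of A E) * len A (X a) = len A E * θ.val (X a) := by
  intro d
  induction d using Nat.strong_induction_on with
  | _ d ih =>
  intro E _ _ _ hd hT hF
  rcases subsingleton_or_nontrivial E with hE | hE
  · have h1 : len A E = 0 := by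
      unfold len
      rw [Module.length_eq_zero]
      rfl
    have h2 : θ.val (ModuleCat.of A E) = 0 := θ.val_sub _
    rw [h1, h2]
    simp
  obtain ⟨i, hi⟩ := S.exists_sub a hT hF
  obtain ⟨hadd, hlen⟩ := S.len_quot a i hi
  have hF2 := S.fre_quot a i hi hF
  have h3 := ih _ (hd ▸ hlen) _ rfl
    (hT.of_surj (LinearMap.range i).mkQ (LinearMap.range i).mkQ_surjective) hF2
  have h4 := θ.add_of_exact (X a) (ModuleCat.of A E) (ModuleCat.of A (E ⧸ LinearMap.range i))
    i (LinearMap.range i).mkQ ‹_› hi (Submodule.mkQ_surjective _)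
    (LinearMap.exact_map_mkQ_range i)
  rw [h4, add_mul, h3, hadd]
  push_cast
  ring

/-- Minimality of a pointed module. -/
def PMin (X : Fin m → ModuleCat.{0} A) (n : ℕ) (E : Type) [AddCommGroup E] [Module A E]
    (e : E) : Prop :=
  ∀ E' : Submodule A E, e ∈ E' → Tor X n E' → E' = ⊤

theorem exists_pmin (n : ℕ) {E : Type} [AddCommGroup E] [Module A E] [Module.Finite A E]
    (hE : Tor X n E) (e : E) : ∃ E' : Submodule A E, ∃ h : e ∈ E', Tor X n E' ∧
      PMin X n E' ⟨e, h⟩ := by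
  obtain ⟨E', ⟨h1, h2⟩, hmin⟩ := IsArtinian.set_has_minimal (R := A) (M := E)
    {E' : Submodule A E | e ∈ E' ∧ Tor X n E'}
    ⟨⊤, trivial, hE.of_surj (Submodule.topEquiv (R := A) (M := E)).symm.toLinearMap
      (Submodule.topEquiv (R := A) (M := E)).symm.surjective⟩
  refine ⟨E', h1, h2, ?_⟩
  intro D hD hDT
  have h3 := hmin (D.map E'.subtype) ⟨⟨_, hD, rfl⟩, ?_⟩
  · by_contra hne
    apply h3
    refine lt_of_le_of_ne (Submodule.map_subtype_le E' D) ?_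
    intro heq
    apply hne
    rw [eq_top_iff]
    rintro ⟨x, hx⟩ -
    rw [← heq] at hx
    obtain ⟨y, hy, hyx⟩ := hx
    have : y = ⟨x, by rw [← hyx]; exact y.2⟩ := Subtype.ext hyx
    rw [← this]
    exact hy
  · exact hDT.of_surj (D.equivMapOfInjective E'.subtype (Submodule.subtype_injective _)).toLinearMap
      (D.equivMapOfInjective E'.subtype (Submodule.subtype_injective _)).surjective

theorem BSetup.len_bound (S : BSetup A X) (a : Fin m) (θ : AddInvariant A)
    (hθ : GoodTheta X a.val θ) : ∃ C : ℕ, ∀ (E : Type) [AddCommGroup E] [Module A E]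
      [Module.Finite A E] (e : E), Tor X (a.val + 1) E → Fre X a.val E →
      PMin X (a.val + 1) E e → len A E ≤ C := by
  obtain ⟨c, hc⟩ := hθ.bound
  have hneg : θ.val (X a) < 0 := hθ.neg _ (S.fin a) (S.brick a).1 (S.fre a le_rfl)
  refine ⟨⌈c * len A (X a) / (-θ.val (X a))⌉₊, ?_⟩
  intro E _ _ _ e hT hF hmin
  have h1 := S.theta_len a θ _ E rfl hT hF
  set I := Submodule.span A {e} with hI
  have hQ : Tor X a.val (E ⧸ I) := S.min_quot a hT hF e hmin
  have h2 := θ.add_of_exact (ModuleCat.of A I) (ModuleCat.of A E) (ModuleCat.of A (E ⧸ I))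
    I.subtype I.mkQ ‹_› (Submodule.subtype_injective _) (Submodule.mkQ_surjective _)
    (LinearMap.exact_subtype_mkQ I)
  have h3 : -c ≤ θ.val (ModuleCat.of A I) := by
    refine hc (ModuleCat.of A I) (⟨e, Submodule.mem_span_singleton_self e⟩ : I) ?_
    rw [eq_top_iff]
    rintro ⟨x, hx⟩ -
    obtain ⟨r, rfl⟩ := Submodule.mem_span_singleton.1 hx
    exact Submodule.mem_span_singleton.2 ⟨r, rfl⟩
  have h4 : 0 ≤ θ.val (ModuleCat.of A (E ⧸ I)) := by
    rcases subsingleton_or_nontrivial (E ⧸ I) with h | h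
    · have : Subsingleton (ModuleCat.of A (E ⧸ I)) := h
      rw [θ.val_sub]
    · exact (hθ.pos (ModuleCat.of A (E ⧸ I)) (inferInstanceAs (Module.Finite A (E ⧸ I))) h hQ).le
  have h5 : (len A E : ℝ) ≤ c * len A (X a) / (-θ.val (X a)) := by
    rw [le_div_iff₀ (by linarith)]
    have : (0 : ℝ) ≤ len A (X a) := Nat.cast_nonneg _
    nlinarith
  exact_mod_cast h5.trans (Nat.le_ceil _)

/-- Left approximations of the regular module in `Tor (a+1) ∩ Fre a`. -/
theorem BSetup.exists_filt_app (S : BSetup A X) (a : Fin m) (θ : AddInvariant A)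
    (hθ : GoodTheta X a.val θ) : ∃ (E : ModuleCat.{0} A) (e : E), Module.Finite A E ∧
      Tor X (a.val + 1) E ∧ Fre X a.val E ∧
      ∀ (M : Type) [AddCommGroup M] [Module A M], Module.Finite A M → Tor X (a.val + 1) M →
        Fre X a.val M → ∀ x : M, ∃ h : E →ₗ[A] M, h e = x := by
  obtain ⟨C, hC⟩ := S.len_bound a θ hθ
  classical
  set Pr : ℕ → Prop := fun d => ∃ (E : ModuleCat.{0} A) (e : E), Module.Finite A E ∧
      Tor X (a.val + 1) E ∧ Fre X a.val E ∧ PMin X (a.val + 1) E e ∧ len A E = d with hPr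
  have hex : ∃ d, Pr d := by
    refine ⟨_, ModuleCat.of A PUnit, (0 : PUnit), inferInstanceAs (Module.Finite A PUnit),
      ?_, ?_, ?_, rfl⟩
    · exact Tor.of_subsingleton (M := PUnit)
    · intro b f hf
      exfalso
      exact hf (by ext x)
    · intro E' _ _
      rw [eq_top_iff]
      intro x _
      rw [Subsingleton.elim (α := PUnit) x 0]
      exact E'.zero_mem
  obtain ⟨d0, hd0⟩ := hex
  have hb : ∀ d, Pr d → d ≤ C := by
    rintro d ⟨E, e, h1, h2, h3, h4, h5⟩
    rw [← h5]
    exact hC E e h2 h3 h4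
  have hmaxP := Nat.findGreatest_spec (P := Pr) (hb d0 hd0) hd0
  have hmax : ∀ d, Pr d → d ≤ Nat.findGreatest Pr C :=
    fun d hd => Nat.le_findGreatest (hb d hd) hd
  obtain ⟨E, e, h1, h2, h3, h4, h5⟩ := hmaxP
  refine ⟨E, e, h1, h2, h3, ?_⟩
  intro M _ _ hM hMT hMF x
  obtain ⟨D, hD, hDT, hDmin⟩ := exists_pmin (a.val + 1) (h2.prod hMT) (e, x)
  have hDF : Fre X a.val D := (h3.prod hMF).of_inj D.subtype (Submodule.subtype_injective _)
  have hDfin : Module.Finite A D := inferInstance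
  have hlen : len A D ≤ len A E := by
    rw [h5]
    exact hmax _ ⟨ModuleCat.of A D, ⟨(e, x), hD⟩, hDfin, hDT, hDF, hDmin, rfl⟩
  set p : D →ₗ[A] E := LinearMap.fst A E M ∘ₗ D.subtype with hp
  have hsurj : Surjective p := by
    rw [← LinearMap.range_eq_top]
    apply h4
    · exact ⟨⟨(e, x), hD⟩, rfl⟩
    · exact hDT.of_surj p.rangeRestrict p.surjective_rangeRestrict
  have hinj : Injective p := by
    by_contra hni
    have := len_lt_of_surj p hsurj hni
    omega
  set eq := LinearEquiv.ofBijective p ⟨hinj, hsurj⟩ with heq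
  refine ⟨LinearMap.snd A E M ∘ₗ D.subtype ∘ₗ eq.symm.toLinearMap, ?_⟩
  have : eq.symm e = ⟨(e, x), hD⟩ := by
    rw [LinearEquiv.symm_apply_eq]
    rfl
  simp [this]

/-- Approximations of arbitrary finite modules. -/
theorem exists_app_of {n : ℕ} {U : ModuleCat.{0} A} {u : U} (hU : IsApp X n U u)
    (N : Type) [AddCommGroup N] [Module A N] [Module.Finite A N] :
    ∃ (V : ModuleCat.{0} A) (v : N →ₗ[A] V), Module.Finite A V ∧ Tor X n V ∧
      ∀ (M : Type) [AddCommGroup M] [Module A M], Module.Finite A M → Tor X n M →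
        ∀ g : N →ₗ[A] M, ∃ h : V →ₗ[A] M, ∀ y, h (v y) = g y := by
  obtain ⟨hUf, hUT, hUa⟩ := hU
  obtain ⟨r, s, hs⟩ := Module.Finite.exists_fin' A N
  set β : (Fin r → A) →ₗ[A] (Fin r → U) :=
    LinearMap.pi (fun i => (LinearMap.toSpanSingleton A U u) ∘ₗ LinearMap.proj i) with hβ
  have hβa : ∀ x i, β x i = x i • u := fun x i => rfl
  set W : Submodule A (Fin r → U) := (LinearMap.ker s).map β with hW
  obtain ⟨v, hv⟩ := factor_surj s hs (W.mkQ ∘ₗ β) (by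
    intro x hx
    rw [LinearMap.comp_apply, Submodule.mkQ_apply, Submodule.Quotient.mk_eq_zero]
    exact ⟨x, hx, rfl⟩)
  refine ⟨ModuleCat.of A ((Fin r → U) ⧸ W), v, inferInstanceAs (Module.Finite A (_ ⧸ W)),
    (hUT.pi (r := r)).of_surj W.mkQ W.mkQ_surjective, ?_⟩
  intro M _ _ hM hMT g
  choose h hh using fun i : Fin r => hUa M hM hMT (g (s (Pi.single i 1)))
  set H : (Fin r → U) →ₗ[A] M := ∑ i, h i ∘ₗ LinearMap.proj i with hH
  have hHβ : ∀ x, H (β x) = g (s x) := by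
    intro x
    have hx : x = ∑ i, x i • (Pi.single i 1 : Fin r → A) := by
      ext j
      simp [Finset.sum_apply, Pi.single_apply]
    conv_rhs => rw [hx]
    simp [hH, hβa, hh]
  obtain ⟨q, hq⟩ := factor_surj W.mkQ W.mkQ_surjective H (by
    intro z hz
    rw [Submodule.mkQ_apply, Submodule.Quotient.mk_eq_zero] at hz
    obtain ⟨x, hx, rfl⟩ := hz
    rw [hHβ, show s x = 0 from hx, map_zero])
  refine ⟨q, fun y => ?_⟩
  obtain ⟨x, rfl⟩ := hs y
  rw [hv, LinearMap.comp_apply]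
  erw [hq]
  exact hHβ x

/-- The inductive step. -/
theorem BSetup.app_succ (S : BSetup A X) (a : Fin m) (θ : AddInvariant A)
    (hθ : GoodTheta X a.val θ) {U : ModuleCat.{0} A} {u : U} (hU : IsApp X a.val U u) :
    ∃ (U' : ModuleCat.{0} A) (u' : U'), IsApp X (a.val + 1) U' u' := by
  obtain ⟨E, e, hEf, hET, hEF, hEa⟩ := S.exists_filt_app a θ hθ
  obtain ⟨r, s0, hs0⟩ := Module.Finite.exists_fin' A E
  set s : (A × (Fin r → A)) →ₗ[A] E :=
    (LinearMap.toSpanSingleton A E e).coprod s0 with hs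
  have hsa : ∀ x y, s (x, y) = x • e + s0 y := fun x y => rfl
  obtain ⟨V, v, hVf, hVT, hVa⟩ := exists_app_of hU (LinearMap.ker s)
  obtain ⟨Y, j, l, π, hgen, hlj, hj, hπl, hπj, hker, huniv⟩ := exists_pushout s v
  refine ⟨Y, l (1, 0), ?_, ?_, ?_⟩
  · refine Module.Finite.of_surjective (j.coprod l) ?_
    intro y
    obtain ⟨x, p, rfl⟩ := hgen y
    exact ⟨(x, p), rfl⟩
  · refine Tor.ext (hVT.mono (Nat.le_succ _)) hET j π ?_ hker
    intro y
    obtain ⟨x, rfl⟩ := hs0 y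
    refine ⟨l (0, x), ?_⟩
    rw [hπl, hsa]
    simp
  · intro M _ _ hM hMT x
    obtain ⟨t, htT, htF⟩ := S.exists_torsion a.val M
    obtain ⟨h0, hh0⟩ := hEa (M ⧸ t) inferInstance (hMT.of_surj t.mkQ t.mkQ_surjective) htF
      (t.mkQ x)
    obtain ⟨g0, hg0⟩ := Module.projective_lifting_property t.mkQ (h0 ∘ₗ s0) t.mkQ_surjective
    set g : (A × (Fin r → A)) →ₗ[A] M := (LinearMap.toSpanSingleton A M x).coprod g0 with hg
    have hga : ∀ x' y, g (x', y) = x' • x + g0 y := fun x y => rfl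
    have hgs : ∀ z, t.mkQ (g z) = h0 (s z) := by
      rintro ⟨x', y⟩
      have := LinearMap.congr_fun hg0 y
      rw [LinearMap.comp_apply, LinearMap.comp_apply] at this
      rw [hga, hsa, map_add, map_add, map_smul, map_smul, hh0, this]
    have hgt : ∀ w : LinearMap.ker s, g w ∈ t := by
      intro w
      have h1 := hgs w
      rw [show s (w : A × (Fin r → A)) = 0 from w.2, map_zero, Submodule.mkQ_apply,
        Submodule.Quotient.mk_eq_zero] at h1
      exact h1
    obtain ⟨h, hh⟩ := hVa t inferInstance htT
      ((g ∘ₗ (LinearMap.ker s).subtype).codRestrict t hgt)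
    obtain ⟨q, hq, -⟩ := huniv M g (t.subtype ∘ₗ h) (by
      intro w
      rw [LinearMap.comp_apply, hh]
      rfl)
    refine ⟨q, ?_⟩
    rw [hq, hga]
    simp

theorem BSetup.app_zero (S : BSetup A X) :
    ∃ (U' : ModuleCat.{0} A) (u' : U'), IsApp X 0 U' u' := by
  refine ⟨ModuleCat.of A PUnit, (0 : PUnit), inferInstanceAs (Module.Finite A PUnit),
    Tor.of_subsingleton (M := PUnit), ?_⟩
  intro M _ _ hM hMT x
  have : Subsingleton M := by
    by_contra hns
    rw [not_subsingleton_iff_nontrivial] at hns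
    obtain ⟨a, ⟨p, hp⟩, -⟩ := S.exists_brick M
    exact absurd (hMT a p (S.ne_zero_surj p hp)) (Nat.not_lt_zero _)
  exact ⟨0, Subsingleton.elim _ _⟩

end Theta
section Pres

variable {A : Type} [Ring A] {m : ℕ} {X : Fin m → ModuleCat.{0} A}
variable [IsArtinianRing A] [IsNoetherianRing A]

theorem exists_min_app {n : ℕ} (h : ∃ (U : ModuleCat.{0} A) (u : U), IsApp X n U u) :
    ∃ (U : ModuleCat.{0} A) (u : U), IsApp X n U u ∧
      ∀ φ : U →ₗ[A] U, φ u = u → Bijective φ := by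
  classical
  have hex : ∃ d, ∃ (U : ModuleCat.{0} A) (u : U), IsApp X n U u ∧ len A U = d := by
    obtain ⟨U, u, hU⟩ := h
    exact ⟨_, U, u, hU, rfl⟩
  obtain ⟨U, u, hU, hd⟩ := Nat.find_spec hex
  refine ⟨U, u, hU, ?_⟩
  intro φ hφ
  obtain ⟨hUf, hUT, hUa⟩ := hU
  have hs : Surjective φ := by
    by_contra hns
    have h1 : IsApp X n (ModuleCat.of A (LinearMap.range φ)) (⟨u, ⟨u, hφ⟩⟩ : LinearMap.range φ) := by
      refine ⟨inferInstanceAs (Module.Finite A (LinearMap.range φ)),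
        hUT.of_surj φ.rangeRestrict φ.surjective_rangeRestrict, ?_⟩
      intro M _ _ hM hMT x
      obtain ⟨h, hh⟩ := hUa M hM hMT x
      exact ⟨h ∘ₗ (LinearMap.range φ).subtype, hh⟩
    have h2 := Nat.find_min' hex ⟨_, _, h1, rfl⟩
    have h3 := len_lt_of_inj (LinearMap.range φ).subtype (Submodule.subtype_injective _) (by
      intro h
      apply hns
      rw [← LinearMap.range_eq_top, ← Submodule.range_subtype (LinearMap.range φ)]
      exact LinearMap.range_eq_top.2 h)
    rw [← hd] at h2
    exact absurd h3 (not_lt.2 h2)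
  exact IsNoetherian.bijective_of_surjective_endomorphism φ hs

/-- Maps from the kernel of a presentation of a minimal approximation extend. -/
theorem extend_app {n : ℕ} {U : ModuleCat.{0} A} {u : U} (hU : IsApp X n U u)
    (hmin : ∀ φ : U →ₗ[A] U, φ u = u → Bijective φ) {P : Type} [AddCommGroup P] [Module A P]
    (π : P →ₗ[A] U) (hπ : Surjective π) (M : Type) [AddCommGroup M] [Module A M]
    [Module.Finite A M] [Module.Finite A P] (hM : Tor X n M) (g : LinearMap.ker π →ₗ[A] M) :
    ∃ h : P →ₗ[A] M, ∀ w : LinearMap.ker π, h w = g w := by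
  obtain ⟨hUf, hUT, hUa⟩ := hU
  obtain ⟨Y, j, l, q, hgen, hlj, hj, hql, hqj, hker, -⟩ := exists_pushout π g
  have hqs : Surjective q := by
    intro y
    obtain ⟨p, rfl⟩ := hπ y
    exact ⟨l p, hql p⟩
  have hYT : Tor X n Y := Tor.ext hM hUT j q hqs hker
  have hYf : Module.Finite A Y := by
    refine Module.Finite.of_surjective (j.coprod l) ?_
    intro y
    obtain ⟨x, p, rfl⟩ := hgen y
    exact ⟨(x, p), rfl⟩
  obtain ⟨y, hy⟩ := hqs u
  obtain ⟨h, hh⟩ := hUa Y hYf hYT y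
  have hb := hmin (q ∘ₗ h) (by rw [LinearMap.comp_apply, hh, hy])
  set e := LinearEquiv.ofBijective (q ∘ₗ h) hb with he
  set σ : U →ₗ[A] Y := h ∘ₗ e.symm.toLinearMap with hσ
  have hqσ : ∀ x, q (σ x) = x := by
    intro x
    exact e.apply_symm_apply x
  have hmem : ∀ p, l p - σ (π p) ∈ LinearMap.range j := by
    intro p
    apply hker
    rw [map_sub, hql, hqσ, sub_self]
  set ej := LinearEquiv.ofInjective j hj with hej
  refine ⟨ej.symm.toLinearMap ∘ₗ (l - σ ∘ₗ π).codRestrict (LinearMap.range j) hmem, ?_⟩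
  intro w
  rw [LinearMap.comp_apply]
  show ej.symm _ = _
  rw [LinearEquiv.symm_apply_eq]
  apply Subtype.ext
  show l w - σ (π w) = j (g w)
  rw [show π (w : P) = 0 from w.2, map_zero, sub_zero, hlj]

/-- Projective covers. -/
theorem exists_cover (N : Type) [AddCommGroup N] [Module A N] [Module.Finite A N] :
    ∃ (P : ModuleCat.{0} A) (d : P →ₗ[A] N), Module.Finite A P ∧ Module.Projective A P ∧
      Surjective d ∧ ∀ W : Submodule A P, W ⊔ LinearMap.ker d = ⊤ → W = ⊤ := by
  classical
  have hex : ∃ k, ∃ (P : ModuleCat.{0} A) (d : P →ₗ[A] N), Module.Finite A P ∧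
      Module.Projective A P ∧ Surjective d ∧ len A P = k := by
    obtain ⟨r, s, hs⟩ := Module.Finite.exists_fin' A N
    exact ⟨_, ModuleCat.of A (Fin r → A), s, inferInstanceAs (Module.Finite A (Fin r → A)),
      inferInstanceAs (Module.Projective A (Fin r → A)), hs, rfl⟩
  obtain ⟨P, d, hPf, hPp, hd, hk⟩ := Nat.find_spec hex
  refine ⟨P, d, hPf, hPp, hd, ?_⟩
  intro W hW
  have hdW : Surjective (d ∘ₗ W.subtype) := by
    intro y
    obtain ⟨x, rfl⟩ := hd y
    have hx : x ∈ W ⊔ LinearMap.ker d := by rw [hW]; trivial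
    obtain ⟨w, hw, z, hz, rfl⟩ := Submodule.mem_sup.1 hx
    refine ⟨⟨w, hw⟩, ?_⟩
    rw [map_add, show d z = 0 from hz, add_zero]
    rfl
  obtain ⟨φ0, hφ0⟩ := Module.projective_lifting_property (d ∘ₗ W.subtype) d hdW
  set φ : Module.End A P := W.subtype ∘ₗ φ0 with hφ
  have hdφ : ∀ x, d (φ x) = d x := fun x => LinearMap.congr_fun hφ0 x
  have hdφn : ∀ (n : ℕ) x, d ((φ ^ n) x) = d x := by
    intro n
    induction n with
    | zero => intro x; rfl
    | succ n ih => intro x; rw [pow_succ', Module.End.mul_apply, hdφ, ih]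
  obtain ⟨n, hn, hc⟩ := ((Filter.eventually_ge_atTop 1).and
    (LinearMap.eventually_isCompl_ker_pow_range_pow φ)).exists
  set R := LinearMap.range (φ ^ n) with hR
  have hRp : Module.Projective A R := by
    refine Module.Projective.of_split R.subtype (Submodule.projectionOnto R _ hc.symm) ?_
    exact Submodule.projectionOnto_comp_subtype hc.symm
  have hRs : Surjective (d ∘ₗ R.subtype) := by
    intro y
    obtain ⟨x, rfl⟩ := hd y
    exact ⟨⟨(φ ^ n) x, ⟨x, rfl⟩⟩, hdφn n x⟩
  have h2 := Nat.find_min' hex ⟨ModuleCat.of A R, d ∘ₗ R.subtype,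
    inferInstanceAs (Module.Finite A R), hRp, hRs, rfl⟩
  rw [← hk] at h2
  have hRtop : R = ⊤ := by
    by_contra hne
    have h3 := len_lt_of_inj R.subtype (Submodule.subtype_injective _) (by
      intro h
      apply hne
      rw [← Submodule.range_subtype R]
      exact LinearMap.range_eq_top.2 h)
    exact absurd h3 (not_lt.2 h2)
  rw [eq_top_iff, ← hRtop]
  rintro _ ⟨x, rfl⟩
  obtain ⟨k, rfl⟩ : ∃ k, n = k + 1 := ⟨n - 1, by omega⟩
  rw [pow_succ', Module.End.mul_apply]
  exact (φ0 _).2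

theorem exists_pres (S : BSetup A X) {n : ℕ}
    (h : ∃ (U : ModuleCat.{0} A) (u : U), IsApp X n U u) :
    ∃ (P0 P1 : ModuleCat.{0} A) (f : P1 →ₗ[A] P0) (v : P0), Module.Finite A P0 ∧
      Module.Finite A P1 ∧ Module.Projective A P0 ∧ Module.Projective A P1 ∧
      (∀ (M : Type) [AddCommGroup M] [Module A M], Module.Finite A M → Tor X n M →
        ∀ (g : P1 →ₗ[A] M) (x : M), ∃ h : P0 →ₗ[A] M, h ∘ₗ f = g ∧ h v = x) ∧
      (∀ (M : Type) [AddCommGroup M] [Module A M], Module.Finite A M → Fre X n M →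
        ∀ h : P0 →ₗ[A] M, h ∘ₗ f = 0 → h = 0) := by
  obtain ⟨U, u, hU, hmin⟩ := exists_min_app h
  have hUf := hU.1
  obtain ⟨r, π, hπ⟩ := Module.Finite.exists_fin' A U
  obtain ⟨P1, d, hP1f, hP1p, hd, hcov⟩ := exists_cover (A := A) (LinearMap.ker π)
  obtain ⟨v, hv⟩ := hπ u
  refine ⟨ModuleCat.of A (Fin r → A), P1, (LinearMap.ker π).subtype ∘ₗ d, v,
    inferInstanceAs (Module.Finite A (Fin r → A)), hP1f,
    inferInstanceAs (Module.Projective A (Fin r → A)), hP1p, ?_, ?_⟩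
  · intro M _ _ hM hMT g x
    have key : ∃ h : (Fin r → A) →ₗ[A] M, h ∘ₗ (LinearMap.ker π).subtype ∘ₗ d = g := by
      set Q := (LinearMap.ker d).map g with hQ
      obtain ⟨g1, hg1⟩ := factor_surj d hd (Q.mkQ ∘ₗ g) (by
        intro x hx
        rw [LinearMap.comp_apply, Submodule.mkQ_apply, Submodule.Quotient.mk_eq_zero]
        exact ⟨x, hx, rfl⟩)
      obtain ⟨h1, hh1⟩ := extend_app hU hmin π hπ (M ⧸ Q)
        (hMT.of_surj Q.mkQ Q.mkQ_surjective) g1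
      obtain ⟨h, hh⟩ := Module.projective_lifting_property Q.mkQ h1 Q.mkQ_surjective
      refine ⟨h, ?_⟩
      set g' := g - h ∘ₗ (LinearMap.ker π).subtype ∘ₗ d with hg'
      have hg'a : ∀ y, g' y = g y - h (d y) := fun y => rfl
      have hg'Q : ∀ y, g' y ∈ Q := by
        intro y
        rw [← Submodule.Quotient.mk_eq_zero, ← Submodule.mkQ_apply, hg'a, map_sub, sub_eq_zero]
        have e1 := LinearMap.congr_fun hh (d y : Fin r → A)
        rw [LinearMap.comp_apply] at e1
        rw [e1, hh1, hg1]
        rfl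
      have htop := hcov (LinearMap.ker g') (by
        rw [eq_top_iff]
        intro y _
        obtain ⟨z, hz, hzy⟩ := hg'Q y
        refine Submodule.mem_sup.2 ⟨y - z, ?_, z, hz, by simp⟩
        rw [LinearMap.mem_ker, map_sub, sub_eq_zero, ← hzy, hg'a, show d z = 0 from hz]
        simp)
      rw [LinearMap.ker_eq_top] at htop
      rw [hg', sub_eq_zero] at htop
      exact htop.symm
    obtain ⟨h1, hh1⟩ := key
    obtain ⟨h2, hh2⟩ := hU.2.2 M hM hMT (x - h1 v)
    refine ⟨h1 + h2 ∘ₗ π, ?_, ?_⟩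
    · rw [← hh1]
      ext y
      have : π (d y : Fin r → A) = 0 := (d y).2
      simp [this]
    · show h1 v + h2 (π v) = x
      rw [hv, hh2]
      abel
  · intro M _ _ hM hMF h hh
    obtain ⟨h', hh'⟩ := factor_surj π hπ h (by
      intro x hx
      obtain ⟨y, hy⟩ := hd ⟨x, hx⟩
      have := LinearMap.congr_fun hh y
      rw [LinearMap.comp_apply, LinearMap.comp_apply, hy] at this
      exact this)
    have h0 := S.hom_zero hU.2.1 hMF h'
    refine LinearMap.ext fun x => ?_
    have := hh' x
    rw [h0] at this
    exact this.symm

end Pres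
section HomDim

open scoped ModuleCat

variable (k : Type) {A : Type} [Field k] [Ring A] [Algebra k A] [FiniteDimensional k A]

theorem finDim_of (M : ModuleCat.{0} A) (hM : Module.Finite A M) : FiniteDimensional k M :=
  Module.Finite.trans A M

theorem finDim_hom (P M : ModuleCat.{0} A) (hP : Module.Finite A P) (hM : Module.Finite A M) :
    FiniteDimensional k (P →ₗ[A] M) := by
  have := finDim_of k P hP
  have := finDim_of k M hM
  refine Module.Finite.of_injective (LinearMap.restrictScalarsₗ k A P M k) ?_
  intro f g h
  ext x
  exact LinearMap.congr_fun h x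

theorem finrank_exact {V W Z : Type} [AddCommGroup V] [Module k V] [AddCommGroup W] [Module k W]
    [AddCommGroup Z] [Module k Z] [FiniteDimensional k W] (i : V →ₗ[k] W) (p : W →ₗ[k] Z)
    (hi : Injective i) (hp : Surjective p) (hip : Exact i p) :
    (Module.finrank k W : ℝ) = Module.finrank k V + Module.finrank k Z := by
  have h1 := LinearMap.finrank_range_add_finrank_ker p
  rw [LinearMap.range_eq_top.2 hp, finrank_top, LinearMap.exact_iff.1 hip,
    LinearMap.finrank_range_of_inj hi] at h1
  rw [← h1]
  push_cast
  ring

/-- The dimension functional. -/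
noncomputable def dimInv : AddInvariant A where
  val M := Module.finrank k M
  iso_inv M N e := by
    rw [LinearEquiv.finrank_eq (e.restrictScalars k)]
  add_of_exact L M N i p hM hi hp hip := by
    have := finDim_of k M hM
    exact finrank_exact k (i.restrictScalars k) (p.restrictScalars k) hi hp hip

/-- Postcomposition, linear over the ground field. -/
def postComp (P : ModuleCat.{0} A) {M N : ModuleCat.{0} A} (p : M →ₗ[A] N) :
    (P →ₗ[A] M) →ₗ[k] (P →ₗ[A] N) where
  toFun g := p ∘ₗ g
  map_add' g h := by ext x; simp
  map_smul' c g := by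
    ext x
    exact (p.restrictScalars k).map_smul c (g x)

/-- The functional `M ↦ dim Hom (P, M)`. -/
noncomputable def hdInv (P : ModuleCat.{0} A) (hP : Module.Finite A P)
    (hPp : Module.Projective A P) : AddInvariant A where
  val M := Module.finrank k (P →ₗ[A] M)
  iso_inv M N e := by
    have : Bijective (postComp k P e.toLinearMap) := by
      constructor
      · intro f g h
        ext x
        exact e.injective (LinearMap.congr_fun h x)
      · intro g
        refine ⟨e.symm.toLinearMap ∘ₗ g, ?_⟩
        ext x
        exact e.apply_symm_apply _
    rw [LinearEquiv.finrank_eq (LinearEquiv.ofBijective _ this)]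
  add_of_exact L M N i p hM hi hp hip := by
    have := finDim_hom k P M hP hM
    refine finrank_exact k (postComp k P i) (postComp k P p) ?_ ?_ ?_
    · intro f g h
      ext x
      exact hi (LinearMap.congr_fun h x)
    · intro g
      exact Module.projective_lifting_property p g hp
    · intro g
      constructor
      · intro h
        have h1 : ∀ x, g x ∈ LinearMap.range i := by
          intro x
          exact (hip _).1 (LinearMap.congr_fun h x)
        refine ⟨(LinearEquiv.ofInjective i hi).symm.toLinearMap ∘ₗ g.codRestrict _ h1, ?_⟩
        ext x
        show i ((LinearEquiv.ofInjective i hi).symm _) = g x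
        have := LinearEquiv.apply_symm_apply (LinearEquiv.ofInjective i hi)
          (g.codRestrict _ h1 x)
        exact congrArg Subtype.val this
      · rintro ⟨h, rfl⟩
        ext x
        exact hip.apply_apply_eq_zero (h x)

/-- Linear combinations of functionals. -/
def AddInvariant.comb {A : Type} [Ring A] (a b : ℝ) (θ η : AddInvariant A) : AddInvariant A where
  val M := a * θ.val M + b * η.val M
  iso_inv M N e := by rw [θ.iso_inv M N e, η.iso_inv M N e]
  add_of_exact L M N i p hM hi hp hip := by
    rw [θ.add_of_exact L M N i p hM hi hp hip, η.add_of_exact L M N i p hM hi hp hip]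
    ring

theorem exists_goodTheta (k : Type) {A : Type} [Field k] [Ring A] [Algebra k A]
    [FiniteDimensional k A] [IsArtinianRing A] [IsNoetherianRing A] {m : ℕ}
    {X : Fin m → ModuleCat.{0} A} (S : BSetup A X) {n : ℕ}
    (h : ∃ (U : ModuleCat.{0} A) (u : U), IsApp X n U u) : ∃ θ, GoodTheta X n θ := by
  obtain ⟨P0, P1, f, v, h0f, h1f, h0p, h1p, hT, hF⟩ := exists_pres S h
  have pre : ∀ M : ModuleCat.{0} A, ∃ F : (P0 →ₗ[A] M) →ₗ[k] (P1 →ₗ[A] M), ∀ h, F h = h ∘ₗ f := by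
    intro M
    exact ⟨{ toFun := fun h => h ∘ₗ f, map_add' := fun _ _ => rfl, map_smul' := fun _ _ => rfl },
      fun _ => rfl⟩
  have ev : ∀ M : ModuleCat.{0} A, ∃ F : (P0 →ₗ[A] M) →ₗ[k] M, ∀ h, F h = h v := by
    intro M
    exact ⟨{ toFun := fun h => h v, map_add' := fun _ _ => rfl, map_smul' := fun _ _ => rfl },
      fun _ => rfl⟩
  set θ : AddInvariant A := ((hdInv k P0 h0f h0p).comb 1 (-1) (hdInv k P1 h1f h1p)).comb 2 (-1)
    (dimInv k) with hθ
  have hval : ∀ M, θ.val M = 2 * (1 * (Module.finrank k (P0 →ₗ[A] M) : ℝ) +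
    -1 * (Module.finrank k (P1 →ₗ[A] M) : ℝ)) + -1 * (Module.finrank k M : ℝ) := fun M => rfl
  refine ⟨θ, ?_, ?_, ?_⟩
  · intro M hM hMn hMT
    have := finDim_of k M hM
    have := finDim_hom k P0 M h0f hM
    have := finDim_hom k P1 M h1f hM
    have hpos : 0 < Module.finrank k M := Module.finrank_pos
    obtain ⟨F, hFF⟩ := pre M
    obtain ⟨E, hE⟩ := ev M
    have hs : Surjective (F.prod E) := by
      rintro ⟨g, x⟩
      obtain ⟨h, hh1, hh2⟩ := hT M hM hMT g x
      refine ⟨h, ?_⟩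
      rw [LinearMap.prod_apply]
      show (F h, E h) = _
      rw [hFF, hE, hh1, hh2]
    have h1 := LinearMap.finrank_le_finrank_of_surjective hs
    rw [Module.finrank_prod] at h1
    rw [hval]
    have h2 : (Module.finrank k (P1 →ₗ[A] M) : ℝ) + Module.finrank k M ≤
      Module.finrank k (P0 →ₗ[A] M) := by exact_mod_cast h1
    have h3 : (0 : ℝ) < Module.finrank k M := by exact_mod_cast hpos
    linarith
  · intro M hM hMn hMF
    have := finDim_of k M hM
    have := finDim_hom k P0 M h0f hM
    have := finDim_hom k P1 M h1f hM
    have hpos : 0 < Module.finrank k M := Module.finrank_pos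
    obtain ⟨F, hFF⟩ := pre M
    have hi : Injective F := by
      rw [injective_iff_map_eq_zero]
      intro h hh
      rw [hFF] at hh
      exact hF M hM hMF h hh
    have h1 := LinearMap.finrank_le_finrank_of_injective hi
    rw [hval]
    have h2 : (Module.finrank k (P0 →ₗ[A] M) : ℝ) ≤
      Module.finrank k (P1 →ₗ[A] M) := by exact_mod_cast h1
    have h3 : (0 : ℝ) < Module.finrank k M := by exact_mod_cast hpos
    linarith
  · set R := ModuleCat.of A A with hR
    refine ⟨2 * (hdInv k P1 h1f h1p).val R + (dimInv k).val R, ?_⟩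
    intro M e he
    set p : R →ₗ[A] M := LinearMap.toSpanSingleton A M e with hp
    have hps : Surjective p := by
      rw [← LinearMap.range_eq_top, ← he]
      exact LinearMap.range_toSpanSingleton e
    have hRf : Module.Finite A R := inferInstanceAs (Module.Finite A A)
    have e1 := (hdInv k P1 h1f h1p).add_of_exact (ModuleCat.of A (LinearMap.ker p)) R M
      (LinearMap.ker p).subtype p hRf (Submodule.subtype_injective _) hps
      (LinearMap.exact_subtype_ker_map p)
    have e2 := (dimInv k).add_of_exact (ModuleCat.of A (LinearMap.ker p)) R M
      (LinearMap.ker p).subtype p hRf (Submodule.subtype_injective _) hps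
      (LinearMap.exact_subtype_ker_map p)
    have n1 : (0 : ℝ) ≤ (hdInv k P1 h1f h1p).val (ModuleCat.of A (LinearMap.ker p)) :=
      Nat.cast_nonneg _
    have n2 : (0 : ℝ) ≤ (dimInv k).val (ModuleCat.of A (LinearMap.ker p)) := Nat.cast_nonneg _
    have n3 : (0 : ℝ) ≤ (hdInv k P0 h0f h0p).val M := Nat.cast_nonneg _
    have hval' : θ.val M = 2 * (1 * (hdInv k P0 h0f h0p).val M +
      -1 * (hdInv k P1 h1f h1p).val M) + -1 * (dimInv k).val M := rfl
    rw [hval']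
    linarith

theorem exists_all_app (k : Type) {A : Type} [Field k] [Ring A] [Algebra k A]
    [FiniteDimensional k A] [IsArtinianRing A] [IsNoetherianRing A] {m : ℕ}
    {X : Fin m → ModuleCat.{0} A} (S : BSetup A X) (n : ℕ) (hn : n ≤ m) :
    ∃ (U : ModuleCat.{0} A) (u : U), IsApp X n U u := by
  induction n with
  | zero => exact S.app_zero
  | succ n ih =>
    have h := ih (by omega)
    obtain ⟨θ, hθ⟩ := exists_goodTheta k S h
    obtain ⟨U, u, hU⟩ := h
    exact S.app_succ ⟨n, by omega⟩ θ hθ hU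

theorem exists_consistent (k : Type) {A : Type} [Field k] [Ring A] [Algebra k A]
    [FiniteDimensional k A] [IsArtinianRing A] [IsNoetherianRing A] {m : ℕ}
    {X : Fin m → ModuleCat.{0} A} (S : BSetup A X)
    (hX : ∀ i j, Nonempty (X i ≃ₗ[A] X j) → i = j) :
    ∃ θ, IsConsistentSequence A true (Fin m) (fun a b => a < b) θ := by
  have hg : ∀ n, ∃ θ, n ≤ m → GoodTheta X n θ := by
    intro n
    by_cases hn : n ≤ m
    · obtain ⟨θ, hθ⟩ := exists_goodTheta k S (exists_all_app k S n hn)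
      exact ⟨θ, fun _ => hθ⟩
    · exact ⟨dimInv k, fun h => absurd h hn⟩
  choose η hη using hg
  set Θ : Fin m → AddInvariant A := fun i => (η i.val).comb ((η (i.val + 1)).val (X i))
    (-(η i.val).val (X i)) (η (i.val + 1)) with hΘ
  have hv : ∀ i M, (Θ i).val M = (η (i.val + 1)).val (X i) * (η i.val).val M +
      -(η i.val).val (X i) * (η (i.val + 1)).val M := fun _ _ => rfl
  have hlow : ∀ i : Fin m, GoodTheta X i.val (η i.val) := fun i => hη _ i.2.le
  have hup : ∀ i : Fin m, GoodTheta X (i.val + 1) (η (i.val + 1)) := fun i => hη _ i.2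
  have hneg : ∀ i, (η i.val).val (X i) < 0 := fun i =>
    (hlow i).neg _ (S.fin i) (S.brick i).1 (S.fre i le_rfl)
  have hpos : ∀ i, 0 < (η (i.val + 1)).val (X i) := fun i =>
    (hup i).pos _ (S.fin i) (S.brick i).1 (S.tor i (Nat.lt_succ_self _))
  have hTpos : ∀ i (M : ModuleCat.{0} A), Module.Finite A M → Nontrivial M → Tor X i.val M →
      0 < (Θ i).val M := by
    intro i M h1 h2 h3
    have a1 := (hlow i).pos M h1 h2 h3
    have a2 := (hup i).pos M h1 h2 (h3.mono (Nat.le_succ _))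
    rw [hv]
    have := mul_pos (hpos i) a1
    have := mul_pos (neg_pos.2 (hneg i)) a2
    linarith
  have hzero : ∀ i, (Θ i).val (X i) = 0 := by
    intro i
    rw [hv]
    ring
  refine ⟨Θ, inferInstance, X, fun j => ⟨S.fin j, S.brick j⟩, hX, S.all, ?_, ?_, ?_⟩
  · intro i j hij
    have hij' : i.val < j.val := hij
    have a1 := (hlow i).neg _ (S.fin j) (S.brick j).1 (S.fre j hij'.le)
    have a2 := (hup i).neg _ (S.fin j) (S.brick j).1 (S.fre j hij')
    rw [hv]
    have := mul_neg_of_pos_of_neg (hpos i) a1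
    have := mul_neg_of_pos_of_neg (neg_pos.2 (hneg i)) a2
    linarith
  · intro i j hij
    simp only [if_true]
    exact hTpos i _ (S.fin j) (S.brick j).1 (S.tor j hij)
  · intro i
    have hst : ∀ (N : ModuleCat.{0} A) (p : X i →ₗ[A] N),
      Function.Surjective p → ¬ Function.Injective p → Nontrivial N → 0 < (Θ i).val N := by
      intro N p hp hni hN
      have := S.fin i
      exact hTpos i N (Module.Finite.of_surjective p hp) hN (S.tor_quot i p hp hni)
    refine ⟨⟨hzero i, ?_⟩, hst⟩
    intro N p hp
    by_cases hi : Injective p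
    · rw [← (Θ i).iso_inv _ _ (LinearEquiv.ofBijective p ⟨hi, hp⟩), hzero]
    · rcases subsingleton_or_nontrivial N with h | h
      · rw [AddInvariant.val_sub]
      · exact (hst N p hp hi h).le

end HomDim
section Order

theorem exists_linear {J : Type} [Finite J] (R : J → J → Prop)
    (hR : ∀ a, ¬ Relation.TransGen R a a) :
    ∃ (m : ℕ) (e : Fin m ≃ J), ∀ a b, R (e a) (e b) → a ≤ b := by
  classical
  have hpo : IsPartialOrder J (Relation.ReflTransGen R) :=
    { refl := fun a => Relation.ReflTransGen.refl
      trans := fun a b c h1 h2 => h1.trans h2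
      antisymm := by
        intro a b h1 h2
        rcases Relation.reflTransGen_iff_eq_or_transGen.1 h1 with h | h
        · exact h.symm
        · exact absurd (h.trans_left h2) (hR a) }
  obtain ⟨s, hs, hle⟩ := extend_partialOrder (Relation.ReflTransGen R)
  have : Fintype J := Fintype.ofFinite J
  letI : LinearOrder J :=
    { le := s
      le_refl := fun a => refl_of s a
      le_trans := fun a b c h1 h2 => trans_of s h1 h2
      le_antisymm := fun a b h1 h2 => antisymm_of s h1 h2
      le_total := fun a b => total_of s a b
      toDecidableLE := Classical.decRel _ }
  set e := Fintype.orderIsoFinOfCardEq J rfl with he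
  refine ⟨_, e.toEquiv, ?_⟩
  intro a b hab
  exact e.le_iff_le.1 (hle _ _ (Relation.ReflTransGen.single hab))

theorem exists_seq {J : Type} (Q : J → J → Prop) {a b : J} (h : Relation.TransGen Q a b) :
    ∃ (m : ℕ) (s : ℕ → J), 1 ≤ m ∧ s 0 = a ∧ s m = b ∧ ∀ i < m, Q (s i) (s (i + 1)) := by
  induction h with
  | @single b h =>
    refine ⟨1, fun i => if i = 0 then a else b, le_rfl, by simp, by simp, ?_⟩
    intro i hi
    obtain rfl : i = 0 := by omega
    simpa using h
  | @tail b c _ h ih =>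
    obtain ⟨m, s, hm, h0, hb, hs⟩ := ih
    refine ⟨m + 1, fun i => if i ≤ m then s i else c, by omega, by simpa using h0, by simp, ?_⟩
    intro i hi
    rcases Nat.lt_or_ge i m with h1 | h1
    · have h2 : i + 1 ≤ m := h1
      simp only [h1.le, h2, if_true]
      exact hs i h1
    · obtain rfl : i = m := by omega
      simp only [le_refl, if_true, hb]
      simpa using h

variable {A : Type} [Ring A]

theorem IsBrick.of_equiv {M N : ModuleCat.{0} A} (h : IsBrick A M) (e : M ≃ₗ[A] N) :
    IsBrick A N := by
  obtain ⟨h1, h2⟩ := h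
  refine ⟨e.toEquiv.symm.nontrivial, ?_⟩
  intro f hf
  have h3 := h2 (e.symm.toLinearMap ∘ₗ f ∘ₗ e.toLinearMap) (by
    intro h0
    apply hf
    ext x
    have := LinearMap.congr_fun h0 (e.symm x)
    simpa using this)
  have h4 : (f : N → N) = e ∘ (e.symm.toLinearMap ∘ₗ f ∘ₗ e.toLinearMap) ∘ e.symm := by
    funext x
    simp
  rw [h4]
  exact e.bijective.comp (h3.comp e.symm.bijective)

theorem exists_setup (hbf : BrickFinite A) (hdir : BrickDirected A) :
    ∃ (m : ℕ) (X : Fin m → ModuleCat.{0} A), BSetup A X ∧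
      ∀ i j, Nonempty (X i ≃ₗ[A] X j) → i = j := by
  classical
  obtain ⟨n, B, hB⟩ := hbf
  set J := {i : Fin n // Module.Finite A (B i) ∧ IsBrick A (B i) ∧
    ∀ j < i, ¬ Nonempty (B i ≃ₗ[A] B j)} with hJ
  have hinj : ∀ i j : J, Nonempty (B i.1 ≃ₗ[A] B j.1) → i = j := by
    rintro i j ⟨e⟩
    rcases lt_trichotomy i.1 j.1 with h | h | h
    · exact absurd ⟨e.symm⟩ (j.2.2.2 _ h)
    · exact Subtype.ext h
    · exact absurd ⟨e⟩ (i.2.2.2 _ h)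
  have hall : ∀ Y : ModuleCat.{0} A, Module.Finite A Y → IsBrick A Y →
      ∃ j : J, Nonempty (Y ≃ₗ[A] B j.1) := by
    intro Y h1 h2
    obtain ⟨i, hi, hmin⟩ := WellFounded.has_min (wellFounded_lt (α := Fin n))
      {i | Nonempty (Y ≃ₗ[A] B i)} (hB Y h1 h2)
    obtain ⟨e⟩ := hi
    refine ⟨⟨i, Module.Finite.equiv e, h2.of_equiv e, ?_⟩, ⟨e⟩⟩
    rintro j hj ⟨e'⟩
    exact hmin j ⟨e.trans e'⟩ hj
  set Q : J → J → Prop := fun a b => a ≠ b ∧ ∃ f : B a.1 →ₗ[A] B b.1, f ≠ 0 with hQ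
  have hac : ∀ a, ¬ Relation.TransGen Q a a := by
    intro a ha
    obtain ⟨m, s, hm, h0, h1, hs⟩ := exists_seq Q ha
    apply hdir
    have hf : ∀ i, ∃ f : B (s i).1 →ₗ[A] B (s (i + 1)).1, i < m → f ≠ 0 := by
      intro i
      by_cases h : i < m
      · obtain ⟨-, f, hf⟩ := hs i h
        exact ⟨f, fun _ => hf⟩
      · exact ⟨0, fun h' => absurd h' h⟩
    choose f hf using hf
    refine ⟨m, fun i => B (s i).1, f, hm, fun i _ => ⟨(s i).2.1, (s i).2.2.1⟩, ?_, ?_⟩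
    · intro i hi
      refine ⟨hf i hi, ?_⟩
      intro hb
      exact (hs i hi).1 (hinj _ _ ⟨LinearEquiv.ofBijective _ hb⟩)
    · show Nonempty (B (s 0).1 ≃ₗ[A] B (s m).1)
      rw [h0, h1]
      exact ⟨LinearEquiv.refl A _⟩
  obtain ⟨m, e, he⟩ := exists_linear (Function.swap Q) (by
    intro a ha
    exact hac a (Relation.transGen_swap.1 ha))
  refine ⟨m, fun i => B (e i).1, ⟨fun a => (e a).2.1, fun a => (e a).2.2.1, ?_, ?_⟩, ?_⟩
  · intro Y h1 h2
    obtain ⟨j, hj⟩ := hall Y h1 h2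
    refine ⟨e.symm j, ?_⟩
    rw [e.apply_symm_apply]
    exact hj
  · intro a b f hf
    by_cases hab : a = b
    · exact hab.ge
    · exact he b a ⟨fun h => hab (e.injective h), f, hf⟩
  · intro i j hij
    exact e.injective (hinj _ _ hij)

theorem directed_of_weak [IsArtinianRing A] [IsNoetherianRing A] {J : Type} {r : J → J → Prop}
    {θ : J → AddInvariant A} (h : IsConsistentSequence A false J r θ) : BrickDirected A := by
  obtain ⟨hr, X, hX, hinj, hall, hneg, hpos, hst⟩ := h
  have htri : ∀ i j, ¬ r i j → i ≠ j → r j i := by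
    intro i j h1 h2
    rcases trichotomous_of r i j with h | h | h
    · exact absurd h h1
    · exact absurd h h2
    · exact h
  have key : ∀ i j (f : X i →ₗ[A] X j), f ≠ 0 → ¬ r i j := by
    intro i j f hf hij
    have := (hX i).1
    have := (hX j).1
    have hnt : Nontrivial (LinearMap.range f) := by
      rw [Submodule.nontrivial_iff_ne_bot]
      intro h0
      exact hf (LinearMap.range_eq_bot.1 h0)
    obtain ⟨B, hBf, hBb, ⟨p, hp⟩, ⟨q, hq⟩⟩ := exists_brick (A := A) _ (LinearMap.range f) rfl
    obtain ⟨l, ⟨e⟩⟩ := hall B hBf hBb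
    have hil : 0 ≤ (θ i).val (X l) := by
      refine (hst i).1.2 (X l) (e.toLinearMap ∘ₗ p ∘ₗ f.rangeRestrict) ?_
      exact e.surjective.comp (hp.comp f.surjective_rangeRestrict)
    have h1 : ¬ r i l := fun h => absurd (hneg i l h) (not_lt.2 hil)
    have h2 : ¬ r l j := by
      intro hlj
      have h3 : 0 ≤ (θ j).val (X l) := by
        have := hpos j l hlj
        simpa using this
      set g : X l →ₗ[A] X j := (LinearMap.range f).subtype ∘ₗ q ∘ₗ e.symm.toLinearMap with hg
      have hgi : Injective g :=
        (Submodule.subtype_injective _).comp (hq.comp e.symm.injective)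
      have hgs : ¬ Surjective g := by
        intro hs
        obtain rfl := hinj l j ⟨LinearEquiv.ofBijective g ⟨hgi, hs⟩⟩
        exact irrefl_of r l hlj
      have h4 := (θ j).add_of_exact (X l) (X j) (ModuleCat.of A (X j ⧸ LinearMap.range g)) g
        (LinearMap.range g).mkQ (hX j).1 hgi (Submodule.mkQ_surjective _)
        (LinearMap.exact_map_mkQ_range g)
      have h5 : Nontrivial (X j ⧸ LinearMap.range g) := by
        rw [Submodule.Quotient.nontrivial_iff]
        intro h
        exact hgs (LinearMap.range_eq_top.1 h)
      have h6 := (hst j).2 (ModuleCat.of A (X j ⧸ LinearMap.range g)) (LinearMap.range g).mkQ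
        (Submodule.mkQ_surjective _) (by
          intro hi
          have hl := (hX l).2.1
          obtain ⟨x, hx⟩ := exists_ne (0 : X l)
          apply hx
          apply hgi
          apply hi
          rw [map_zero, map_zero, Submodule.mkQ_apply, Submodule.Quotient.mk_eq_zero]
          exact ⟨x, rfl⟩) h5
      have h7 := (hst j).1.1
      linarith
    by_cases hil' : i = l
    · subst hil'
      exact h2 hij
    · exact h2 (trans_of r (htri i l h1 hil') hij)
  rintro ⟨m, Y, f, hm, hY, hf, ⟨e⟩⟩
  have hidx : ∀ t, ∃ j, t ≤ m → Nonempty (Y t ≃ₗ[A] X j) := by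
    intro t
    by_cases ht : t ≤ m
    · obtain ⟨j, hj⟩ := hall _ (hY t ht).1 (hY t ht).2
      exact ⟨j, fun _ => hj⟩
    · obtain ⟨j, hj⟩ := hall _ (hY m le_rfl).1 (hY m le_rfl).2
      exact ⟨j, fun h => absurd h ht⟩
  choose s hs using hidx
  have hstep : ∀ t < m, r (s (t + 1)) (s t) := by
    intro t ht
    obtain ⟨e1⟩ := hs t ht.le
    obtain ⟨e2⟩ := hs (t + 1) ht
    obtain ⟨hf0, hfb⟩ := hf t ht
    set g : X (s t) →ₗ[A] X (s (t + 1)) := e2.toLinearMap ∘ₗ f t ∘ₗ e1.symm.toLinearMap with hg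
    have hg0 : g ≠ 0 := by
      intro h0
      apply hf0
      ext x
      have := LinearMap.congr_fun h0 (e1 x)
      simpa [hg] using this
    refine htri _ _ (key _ _ g hg0) ?_
    intro heq
    -- the two bricks are isomorphic
    have eY : Y t ≃ₗ[A] Y (t + 1) := e1.trans ((heq ▸ LinearEquiv.refl A (X (s t)) :
      X (s t) ≃ₗ[A] X (s (t + 1))).trans e2.symm)
    have hb := (hY t ht.le).2.2 (eY.symm.toLinearMap ∘ₗ f t) (by
      intro h0
      apply hf0
      ext x
      have := LinearMap.congr_fun h0 x
      simpa using this)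
    apply hfb
    have h4 : (f t : Y t → Y (t + 1)) = eY ∘ (eY.symm.toLinearMap ∘ₗ f t) := by
      funext x
      simp
    rw [h4]
    exact eY.bijective.comp hb
  have hchain : ∀ t, t < m → r (s (t + 1)) (s 0) := by
    intro t
    induction t with
    | zero => intro ht; exact hstep 0 ht
    | succ t ih => intro ht; exact trans_of r (hstep _ ht) (ih (by omega))
  have hend : s 0 = s m := by
    obtain ⟨e1⟩ := hs 0 (Nat.zero_le _)
    obtain ⟨e2⟩ := hs m le_rfl
    exact hinj _ _ ⟨e1.symm.trans (e.trans e2)⟩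
  have h1 := hchain (m - 1) (by omega)
  rw [show m - 1 + 1 = m by omega, hend] at h1
  exact irrefl_of r _ h1

theorem weak_of_strict {J : Type} {r : J → J → Prop}
    {θ : J → AddInvariant A} (h : IsConsistentSequence A true J r θ) :
    IsConsistentSequence A false J r θ := by
  obtain ⟨hr, X, hX, hinj, hall, hneg, hpos, hst⟩ := h
  refine ⟨hr, X, hX, hinj, hall, hneg, ?_, hst⟩
  intro i j hij
  have := hpos i j hij
  simp only [if_true] at this
  simpa using this.le

end Order

theorem stmt14 (k A : Type) [Field k] [Ring A] [Algebra k A] [FiniteDimensional k A]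
    (hbf : BrickFinite A) :
    -- (1) ↔ (2)
    (BrickDirected A ↔
      ∃ (J : Type) (r : J → J → Prop) (θ : J → AddInvariant A),
        IsConsistentSequence A true J r θ) ∧
    -- (1) ↔ (3)
    (BrickDirected A ↔
      ∃ (J : Type) (r : J → J → Prop) (θ : J → AddInvariant A),
        IsConsistentSequence A false J r θ) := by
  have hart : IsArtinianRing A := IsArtinianRing.of_finite k A
  have hnoe : IsNoetherianRing A := IsNoetherianRing.of_finite k A
  have h12 : BrickDirected A → ∃ (J : Type) (r : J → J → Prop) (θ : J → AddInvariant A),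
      IsConsistentSequence A true J r θ := by
    intro hd
    obtain ⟨m, X, S, hX⟩ := exists_setup hbf hd
    obtain ⟨θ, hθ⟩ := exists_consistent k S hX
    exact ⟨Fin m, _, θ, hθ⟩
  refine ⟨⟨h12, ?_⟩, ⟨?_, ?_⟩⟩
  · rintro ⟨J, r, θ, h⟩
    exact directed_of_weak (weak_of_strict h)
  · intro hd
    obtain ⟨J, r, θ, h⟩ := h12 hd
    exact ⟨J, r, θ, weak_of_strict h⟩
  · rintro ⟨J, r, θ, h⟩
    exact directed_of_weak h
end

section
/- Let A be a brick-finite finite-dimensional algebra. If A is brick-directed, then each brick in mod A is uniquely determined by its dimension vector: for any two non-isomorphic bricks X and Y, the classes [X] and [Y] in the Grothendieck group K_0(mod A) are distinct. -/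
open Function

namespace BrickJH

universe u

/-- Object-level short exact sequence calculus (a self-dual list of facts). -/
structure Ex {O : Type u} (Z : O) (Ses : O → O → O → Prop) : Prop where
  zl : ∀ M, Ses Z M M
  zr : ∀ M, Ses M M Z
  zl' : ∀ {M N}, Ses Z M N → M = N
  zr' : ∀ {L M}, Ses L M Z → L = M
  zm : ∀ {L N}, Ses L Z N → L = Z ∧ N = Z
  pullM : ∀ {N E M Q R}, Ses N E M → Ses Q M R → ∃ E', Ses N E' Q ∧ Ses E' E R
  pushE : ∀ {N E M K I}, Ses N E M → Ses K N I → ∃ E', Ses I E' M ∧ Ses K E E'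
  pullE : ∀ {N E M K Q}, Ses N E M → Ses K Q M → ∃ E', Ses N E' Q ∧ Ses K E' E
  pushM : ∀ {N E M N' R}, Ses N E M → Ses N N' R → ∃ E', Ses N' E' M ∧ Ses E E' R
  dia : ∀ {M K1 S1 K2 S2}, Ses K1 M S1 → Ses K2 M S2 →
    ∃ D I I' C, Ses D K1 I ∧ Ses I S2 C ∧ Ses D K2 I' ∧ Ses I' S1 C

/-- A torsion pair together with an integral additive function, positive on `T`, negative on `F`. -/
structure TP {O : Type u} (Z : O) (Ses : O → O → O → Prop) (T F : O → Prop) (θ : O → ℤ) :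
    Prop where
  tz : T Z
  fz : F Z
  tq : ∀ {L M N}, Ses L M N → T M → T N
  fs : ∀ {L M N}, Ses L M N → F M → F L
  te : ∀ {L M N}, Ses L M N → T L → T N → T M
  fe : ∀ {L M N}, Ses L M N → F L → F N → F M
  tf : ∀ {M}, T M → F M → M = Z
  dec : ∀ M, ∃ L N, Ses L M N ∧ T L ∧ F N
  add : ∀ {L M N}, Ses L M N → θ M = θ L + θ N
  pos : ∀ {M}, T M → M ≠ Z → 0 < θ M
  neg : ∀ {M}, F M → M ≠ Z → θ M < 0

/-- objects of `T` that are simple in the tilted heart -/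
def TS {O : Type u} (Z : O) (Ses : O → O → O → Prop) (T : O → Prop) (B : O) : Prop :=
  T B ∧ B ≠ Z ∧ ∀ K L I C, T L → Ses K L I → Ses I B C → I ≠ Z → C = Z ∧ T K

/-- objects of `F` whose shift is simple in the tilted heart -/
def FS {O : Type u} (Z : O) (Ses : O → O → O → Prop) (F : O → Prop) (B : O) : Prop :=
  F B ∧ B ≠ Z ∧ ∀ K L I C, F L → Ses I L K → Ses C B I → I ≠ Z → C = Z ∧ F K

def Step {O : Type u} (Z : O) (Ses : O → O → O → Prop) (T F : O → Prop) (wT wF : O → ℤ)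
    (M X : O) (w : ℤ) : Prop :=
  T X ∧ ((∃ S, TS Z Ses T S ∧ Ses X M S ∧ w = wT S) ∨ (∃ S, FS Z Ses F S ∧ Ses S X M ∧ w = wF S))

inductive Ser {O : Type u} (Z : O) (Ses : O → O → O → Prop) (T F : O → Prop) (wT wF : O → ℤ) :
    O → ℤ → Prop
  | zero : Ser Z Ses T F wT wF Z 0
  | step {M X w n} : T M → Step Z Ses T F wT wF M X w → Ser Z Ses T F wT wF X n →
      Ser Z Ses T F wT wF M (n + w)

section
variable {O : Type u} {Z : O} {Ses : O → O → O → Prop} {T F : O → Prop} {θ wT wF : O → ℤ}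

theorem Ex.op (h : Ex Z Ses) : Ex Z (fun L M N => Ses N M L) where
  zl := h.zr
  zr := h.zl
  zl' := fun a => (h.zr' a).symm
  zr' := fun a => (h.zl' a).symm
  zm := fun a => (h.zm a).symm
  pullM := fun a b => h.pushE a b
  pushE := fun a b => h.pullM a b
  pullE := fun a b => h.pushM a b
  pushM := fun a b => h.pullE a b
  dia := fun a b => by
    obtain ⟨D, I, I', C, h1, h2, h3, h4⟩ := h.dia a b
    exact ⟨C, I', I, D, h4, h3, h2, h1⟩

theorem TP.op (h : TP Z Ses T F θ) : TP Z (fun L M N => Ses N M L) F T (fun M => - θ M) where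
  tz := h.fz
  fz := h.tz
  tq := fun a b => h.fs a b
  fs := fun a b => h.tq a b
  te := fun a b c => h.fe a c b
  fe := fun a b c => h.te a c b
  tf := fun a b => h.tf b a
  dec := fun M => by
    obtain ⟨L, N, a, b, c⟩ := h.dec M
    exact ⟨N, L, a, c, b⟩
  add := fun a => by have := h.add a; omega
  pos := fun a b => by have := h.neg a b; omega
  neg := fun a b => by have := h.pos a b; omega

theorem TP.z (e : Ex Z Ses) (h : TP Z Ses T F θ) : θ Z = 0 := by
  have := h.add (e.zl Z); omega

theorem TP.nonneg (e : Ex Z Ses) (h : TP Z Ses T F θ) {M} (hM : T M) : 0 ≤ θ M := by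
  by_cases hz : M = Z
  · rw [hz, h.z e]
  · exact (h.pos hM hz).le

theorem Ex.nz_mid_l (e : Ex Z Ses) {L M N} (h : Ses L M N) (hL : L ≠ Z) : M ≠ Z := by
  rintro rfl; exact hL (e.zm h).1

theorem Ex.nz_mid_r (e : Ex Z Ses) {L M N} (h : Ses L M N) (hL : N ≠ Z) : M ≠ Z := by
  rintro rfl; exact hL (e.zm h).2

theorem Step.lt (h : TP Z Ses T F θ) {M X w} (hs : Step Z Ses T F wT wF M X w) :
    θ X < θ M := by
  obtain ⟨hX, ⟨S, hS, hx, -⟩ | ⟨S, hS, hx, -⟩⟩ := hs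
  · have := h.add hx; have := h.pos hS.1 hS.2.1; omega
  · have := h.add hx; have := h.neg hS.1 hS.2.1; omega

/-- Existence of a simple quotient in the tilted heart. -/
theorem exists_step (e : Ex Z Ses) (h : TP Z Ses T F θ) {M} (hM : T M) (hz : M ≠ Z) :
    ∃ X w, Step Z Ses T F wT wF M X w := by
  classical
  let P : ℕ → Prop := fun n =>
    (∃ Q K, T K ∧ Ses K M Q ∧ Q ≠ Z ∧ θ Q = n) ∨
    (∃ N E, T E ∧ F N ∧ Ses N E M ∧ N ≠ Z ∧ - θ N = n)
  have hP : ∃ n, P n := ⟨(θ M).toNat, Or.inl ⟨M, Z, h.tz, e.zl M, hz, by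
    have := h.pos hM hz; omega⟩⟩
  have hmin := fun m => @Nat.find_min P _ hP m
  obtain ⟨Q, K1, hK1, hs, hQ, hn⟩ | ⟨N, E, hE, hN, hs, hN0, hn⟩ := Nat.find_spec hP
  · have hTQ := h.tq hs hM
    refine ⟨K1, wT Q, hK1, Or.inl ⟨Q, ⟨hTQ, hQ, ?_⟩, hs, rfl⟩⟩
    intro K0 L I C hL h1 h2 hI
    have hTI := h.tq h1 hL
    have hC : C = Z := by
      by_contra hC
      obtain ⟨E', h3, h4⟩ := e.pullM hs h2
      have hTC := h.tq h2 hTQ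
      have := h.pos hTC hC
      have := h.pos hTI hI
      have := h.add h2
      exact hmin (θ C).toNat (by omega) (Or.inl ⟨C, E', h.te h3 hK1 hTI, h4, hC, by omega⟩)
    refine ⟨hC, ?_⟩
    subst hC
    have := e.zr' h2
    subst this
    obtain ⟨t, f, h3, ht, hf⟩ := h.dec K0
    by_cases hf0 : f = C
    · subst hf0; rw [← e.zr' h3]; exact ht
    exfalso
    obtain ⟨L', h4, h5⟩ := e.pushE h1 h3
    obtain ⟨E, h6, h7⟩ := e.pullE h4 hs
    have hTL := h.tq h5 hL
    have := h.add h4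
    have := h.neg hf hf0
    have hL0 : L' ≠ C := e.nz_mid_r h4 hI
    have := h.pos hTL hL0
    exact hmin (-θ f).toNat (by omega) (Or.inr ⟨f, E, h.te h7 hK1 hTL, hf, h6, hf0, by omega⟩)
  · refine ⟨E, wF N, hE, Or.inr ⟨N, ⟨hN, hN0, ?_⟩, hs, rfl⟩⟩
    intro C' N' I K hN' h1 h2 hI
    have hFI := h.fs h1 hN'
    have hFK := h.fs h2 hN
    have hK : K = Z := by
      by_contra hK
      obtain ⟨E', h3, h4⟩ := e.pushE hs h2
      have := h.neg hFK hK
      have := h.neg hFI hI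
      have := h.add h2
      exact hmin (-θ I).toNat (by omega) (Or.inr ⟨I, E', h.tq h4 hE, hFI, h3, hI, by omega⟩)
    refine ⟨hK, ?_⟩
    subst hK
    have := e.zl' h2
    subst this
    obtain ⟨t, f, h3, ht, hf⟩ := h.dec C'
    by_cases ht0 : t = K
    · subst ht0; rw [e.zl' h3]; exact hf
    exfalso
    obtain ⟨N'', h4, h5⟩ := e.pullM h1 h3
    obtain ⟨E'', h6, h7⟩ := e.pushM hs h4
    have hFN := h.fs h5 hN'
    have hN''0 : N'' ≠ K := e.nz_mid_l h4 hI
    have := h.neg hFN hN''0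
    have := h.add h4
    have := h.pos ht ht0
    exact hmin (-θ N'').toNat (by omega)
      (Or.inr ⟨N'', E'', h.te h7 hE ht, hFN, h6, hN''0, by omega⟩)

theorem exists_ser (e : Ex Z Ses) (h : TP Z Ses T F θ) :
    ∀ (n : ℕ) (M), T M → θ M ≤ n → ∃ m, Ser Z Ses T F wT wF M m := by
  intro n
  induction n with
  | zero =>
    intro M hM hn
    by_cases hz : M = Z
    · subst hz; exact ⟨0, .zero⟩
    · have := h.pos hM hz; omega
  | succ n ih =>
    intro M hM hn
    by_cases hz : M = Z
    · subst hz; exact ⟨0, .zero⟩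
    · obtain ⟨X, w, hs⟩ := exists_step (wT := wT) (wF := wF) e h hM hz
      obtain ⟨m, hm⟩ := ih X hs.1 (by have := hs.lt h; omega)
      exact ⟨_, .step hM hs hm⟩

theorem no_step_zero (e : Ex Z Ses) (h : TP Z Ses T F θ) {X w}
    (hs : Step Z Ses T F wT wF Z X w) : False := by
  obtain ⟨hX, ⟨S, hS, hx, -⟩ | ⟨S, hS, hx, -⟩⟩ := hs
  · exact hS.2.1 (e.zm hx).2
  · have := e.zr' hx
    subst this
    exact hS.2.1 (h.tf hX hS.1)

theorem step_diamond (e : Ex Z Ses) (h : TP Z Ses T F θ) {M X1 X2 w1 w2}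
    (s1 : Step Z Ses T F wT wF M X1 w1) (s2 : Step Z Ses T F wT wF M X2 w2) :
    (X1 = X2 ∧ w1 = w2) ∨
    ∃ D, Step Z Ses T F wT wF X1 D w2 ∧ Step Z Ses T F wT wF X2 D w1 := by
  have key : ∀ X1 X2 S S' : O, T X1 → T X2 → TS Z Ses T S → FS Z Ses F S' → Ses X1 M S →
      Ses S' X2 M → ∃ D, T D ∧ Ses S' D X1 ∧ Ses D X2 S := by
    intro X1 X2 S S' hX1 hX2 hS hS' h1 h2
    obtain ⟨D, h3, h4⟩ := e.pullM h2 h1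
    exact ⟨D, (hS.2.2 _ _ _ _ hX2 h4 (e.zr S) hS.2.1).2, h3, h4⟩
  obtain ⟨hX1, ⟨S1, hS1, h1, rfl⟩ | ⟨S1, hS1, h1, rfl⟩⟩ := s1 <;>
  obtain ⟨hX2, ⟨S2, hS2, h2, rfl⟩ | ⟨S2, hS2, h2, rfl⟩⟩ := s2
  · obtain ⟨D, I, I', C, a1, a2, a3, a4⟩ := e.dia h1 h2
    by_cases hI : I = Z
    · subst hI
      have b1 := e.zr' a1
      have b2 := e.zl' a2
      by_cases hI' : I' = I
      · subst hI'
        have b3 := e.zr' a3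
        have b4 := e.zl' a4
        left
        subst b1 b2 b3
        exact ⟨rfl, by rw [b4]⟩
      · have := (hS1.2.2 _ _ _ _ hX2 a3 a4 hI').1
        exact absurd (b2.trans this) hS2.2.1
    · obtain ⟨hC, hD⟩ := hS2.2.2 _ _ _ _ hX1 a1 a2 hI
      subst hC
      have b2 := e.zr' a2
      have b4 := e.zr' a4
      subst b2 b4
      right
      exact ⟨D, ⟨hD, Or.inl ⟨_, hS2, a1, rfl⟩⟩, ⟨hD, Or.inl ⟨_, hS1, a3, rfl⟩⟩⟩
  · obtain ⟨D, hD, a1, a2⟩ := key _ _ _ _ hX1 hX2 hS1 hS2 h1 h2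
    exact Or.inr ⟨D, ⟨hD, Or.inr ⟨_, hS2, a1, rfl⟩⟩, ⟨hD, Or.inl ⟨_, hS1, a2, rfl⟩⟩⟩
  · obtain ⟨D, hD, a1, a2⟩ := key _ _ _ _ hX2 hX1 hS2 hS1 h2 h1
    exact Or.inr ⟨D, ⟨hD, Or.inl ⟨_, hS2, a2, rfl⟩⟩, ⟨hD, Or.inr ⟨_, hS1, a1, rfl⟩⟩⟩
  · obtain ⟨E', a1, a2⟩ := e.pullE h1 h2
    obtain ⟨t, f, h3, ht, hf⟩ := h.dec E'
    by_cases hf0 : f = Z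
    · subst hf0
      have := e.zr' h3
      subst this
      exact Or.inr ⟨t, ⟨ht, Or.inr ⟨_, hS2, a2, rfl⟩⟩, ⟨ht, Or.inr ⟨_, hS1, a1, rfl⟩⟩⟩
    · have key2 : ∀ S X, T X → FS Z Ses F S → Ses S E' X → S = f ∧ t = X := by
        intro S X hX hS hs
        obtain ⟨D, I, I', C, b1, b2, b3, b4⟩ := e.dia hs h3
        have hTC := h.tq b4 hX
        by_cases hI : I = Z
        · subst hI
          have := e.zl' b2
          subst this
          exact absurd (h.tf hTC hf) hf0
        · obtain ⟨hD, hC⟩ := hS.2.2 _ _ _ _ hf b2 b1 hI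
          have := h.tf hTC hC
          subst this
          subst hD
          have := e.zr' b2
          have := e.zr' b4
          have := e.zl' b1
          have := e.zl' b3
          subst_vars
          exact ⟨rfl, rfl⟩
      obtain ⟨c1, c2⟩ := key2 _ _ hX2 hS1 a1
      obtain ⟨c3, c4⟩ := key2 _ _ hX1 hS2 a2
      left
      exact ⟨c4.symm.trans c2, by rw [c1, c3]⟩

theorem ser_unique (e : Ex Z Ses) (h : TP Z Ses T F θ) :
    ∀ (n : ℕ) (M m1 m2), T M → θ M ≤ n → Ser Z Ses T F wT wF M m1 → Ser Z Ses T F wT wF M m2 →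
      m1 = m2 := by
  intro n
  induction n with
  | zero =>
    intro M m1 m2 hM hn s1 s2
    have hz : M = Z := by
      by_contra hz
      have := h.pos hM hz; omega
    subst hz
    cases s1 with
    | zero => cases s2 with
      | zero => rfl
      | step _ hs _ => exact (no_step_zero e h hs).elim
    | step _ hs _ => exact (no_step_zero e h hs).elim
  | succ n ih =>
    intro M m1 m2 hM hn s1 s2
    cases s1 with
    | zero => cases s2 with
      | zero => rfl
      | step _ hs _ => exact (no_step_zero e h hs).elim
    | step _ hs hr => cases s2 with
      | zero => exact (no_step_zero e h hs).elim
      | step _ hs' hr' =>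
        have l1 := hs.lt h
        have l2 := hs'.lt h
        obtain ⟨rfl, rfl⟩ | ⟨D, d1, d2⟩ := step_diamond e h hs hs'
        · rw [ih _ _ _ hs.1 (by omega) hr hr']
        · obtain ⟨d, hd⟩ := exists_ser (wT := wT) (wF := wF) e h (θ D).toNat D d1.1 (by omega)
          have e1 := ih _ _ _ hs.1 (by omega) hr (.step hs.1 d1 hd)
          have e2 := ih _ _ _ hs'.1 (by omega) hr' (.step hs'.1 d2 hd)
          omega

/-- weighted length on `T` -/
theorem exists_mT (e : Ex Z Ses) (h : TP Z Ses T F θ) (wT wF : O → ℤ) :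
    ∃ m : O → ℤ, m Z = 0 ∧ (∀ M X w, T M → Step Z Ses T F wT wF M X w → m M = m X + w) := by
  classical
  have hex : ∀ M, ∃ m, T M → Ser Z Ses T F wT wF M m := by
    intro M
    by_cases hM : T M
    · obtain ⟨m, hm⟩ := exists_ser (wT := wT) (wF := wF) e h (θ M).toNat M hM (by omega)
      exact ⟨m, fun _ => hm⟩
    · exact ⟨0, fun a => absurd a hM⟩
  choose m hm using hex
  refine ⟨m, ser_unique e h (θ Z).toNat Z _ _ h.tz (by omega) (hm _ h.tz) .zero, ?_⟩
  intro M X w hM hs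
  exact ser_unique e h (θ M).toNat M _ _ hM (by omega) (hm _ hM) (.step hM hs (hm _ hs.1))

theorem Step.op_iff {M X : O} {w : ℤ} :
    Step Z (fun L M N => Ses N M L) F T wF wT M X w ↔
    F X ∧ ((∃ S, FS Z Ses F S ∧ Ses S M X ∧ w = wF S) ∨
      (∃ S, TS Z Ses T S ∧ Ses M X S ∧ w = wT S)) := Iff.rfl

theorem mT_a (e : Ex Z Ses) (h : TP Z Ses T F θ) {m : O → ℤ} (m0 : m Z = 0)
    (hm : ∀ M X w, T M → Step Z Ses T F wT wF M X w → m M = m X + w) :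
    ∀ (n : ℕ) (L M N), Ses L M N → T L → T N → θ N ≤ n → m M = m L + m N := by
  intro n
  induction n with
  | zero =>
    intro L M N hs hL hN hn
    have hz : N = Z := by
      by_contra hz
      have := h.pos hN hz; omega
    subst hz
    rw [e.zr' hs, m0, add_zero]
  | succ n ih =>
    intro L M N hs hL hN hn
    by_cases hz : N = Z
    · subst hz
      rw [e.zr' hs, m0, add_zero]
    have hM := h.te hs hL hN
    obtain ⟨X, w, hX⟩ := exists_step (wT := wT) (wF := wF) e h hN hz
    have l := hX.lt h
    have e1 := hm _ _ _ hN hX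
    obtain ⟨hTX, ⟨S, hS, h1, hw⟩ | ⟨S, hS, h1, hw⟩⟩ := hX
    · obtain ⟨E, h2, h3⟩ := e.pullM hs h1
      have hE := h.te h2 hL hTX
      have := hm M E w hM ⟨hE, Or.inl ⟨S, hS, h3, hw⟩⟩
      have := ih _ _ _ h2 hL hTX (by omega)
      omega
    · obtain ⟨E, h2, h3⟩ := e.pullE hs h1
      have hE := h.te h2 hL hTX
      have := hm M E w hM ⟨hE, Or.inr ⟨S, hS, h3, hw⟩⟩
      have := ih _ _ _ h2 hL hTX (by omega)
      omega

theorem mT_c (e : Ex Z Ses) (h : TP Z Ses T F θ) {m m' : O → ℤ} (m0' : m' Z = 0)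
    (hm : ∀ M X w, T M → Step Z Ses T F wT wF M X w → m M = m X + w)
    (hm' : ∀ M X w, F M → Step Z (fun L M N => Ses N M L) F T wF wT M X w → m' M = m' X + w) :
    ∀ (n : ℕ) (L M N), Ses L M N → F L → T M → - θ L ≤ n → m N = m M + m' L := by
  intro n
  induction n with
  | zero =>
    intro L M N hs hL hM hn
    have hz : L = Z := by
      by_contra hz
      have := h.neg hL hz; omega
    subst hz
    rw [e.zl' hs, m0', add_zero]
  | succ n ih =>
    intro L M N hs hL hM hn
    by_cases hz : L = Z
    · subst hz
      rw [e.zl' hs, m0', add_zero]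
    obtain ⟨X, w, hX⟩ := exists_step (wT := wF) (wF := wT) e.op h.op hL hz
    have l := hX.lt h.op
    have e1 := hm' _ _ _ hL hX
    obtain ⟨hTX, ⟨S, hS, h1, hw⟩ | ⟨S, hS, h1, hw⟩⟩ := hX
    · obtain ⟨E, h2, h3⟩ := e.pushE hs h1
      have hE := h.tq h3 hM
      have := hm E M w hE ⟨hM, Or.inr ⟨S, hS, h3, hw⟩⟩
      have := ih _ _ _ h2 hTX hE (by omega)
      omega
    · obtain ⟨E, h2, h3⟩ := e.pushM hs h1
      have hE := h.te h3 hM hS.1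
      have := hm E M w hE ⟨hM, Or.inl ⟨S, hS, h3, hw⟩⟩
      have := ih _ _ _ h2 hTX hE (by omega)
      omega

theorem dec_unique (e : Ex Z Ses) (h : TP Z Ses T F θ) {M L N L' N'} (h1 : Ses L M N)
    (h2 : Ses L' M N') (hL : T L) (hL' : T L') (hN : F N) (hN' : F N') : L = L' ∧ N = N' := by
  obtain ⟨D, I, I', C, b1, b2, b3, b4⟩ := e.dia h1 h2
  have hI := h.tf (h.tq b1 hL) (h.fs b2 hN')
  have hI' := h.tf (h.tq b3 hL') (h.fs b4 hN)
  subst hI hI'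
  have := e.zr' b1
  have := e.zl' b2
  have := e.zr' b3
  have := e.zl' b4
  subst_vars
  exact ⟨rfl, rfl⟩

/-- Jordan-Hölder: arbitrary weights on the simples of the heart give additive functions. -/
theorem exists_additive (e : Ex Z Ses) (h : TP Z Ses T F θ) (wT wF : O → ℤ) :
    ∃ φ : O → ℤ, (∀ L M N, Ses L M N → φ M = φ L + φ N) ∧
      (∀ S, TS Z Ses T S → φ S = wT S) ∧ (∀ S, FS Z Ses F S → φ S = - wF S) := by
  obtain ⟨m, m0, hm⟩ := exists_mT e h wT wF
  obtain ⟨m', m0', hm'⟩ := exists_mT e.op h.op wF wT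
  have ha : ∀ L M N, Ses L M N → T L → T N → m M = m L + m N := fun L M N a b c =>
    mT_a e h m0 hm (θ N).toNat L M N a b c (by omega)
  have hb : ∀ L M N, Ses L M N → F L → F N → m' M = m' N + m' L := fun L M N a b c =>
    mT_a e.op h.op m0' hm' (- θ L).toNat N M L a c b (by omega)
  have hc : ∀ L M N, Ses L M N → F L → T M → m N = m M + m' L := fun L M N a b c =>
    mT_c e h m0' hm hm' (- θ L).toNat L M N a b c (by omega)
  have hd : ∀ L M N, Ses L M N → F M → T N → m' L = m' M + m N := fun L M N a b c =>
    mT_c e.op h.op m0 hm' hm (θ N).toNat N M L a c b (by simp)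
  choose t f hs ht hf using h.dec
  have hu : ∀ M L N, Ses L M N → T L → F N → t M = L ∧ f M = N := fun M L N a b c =>
    dec_unique e h (hs M) a (ht M) b (hf M) c
  have htT : ∀ M, T M → t M = M ∧ f M = Z := fun M hM => hu M M Z (e.zr M) hM h.fz
  have htF : ∀ M, F M → t M = Z ∧ f M = M := fun M hM => hu M Z M (e.zl M) h.tz hM
  let φ : O → ℤ := fun M => m (t M) - m' (f M)
  have φd : ∀ M, φ M = m (t M) - m' (f M) := fun _ => rfl
  have φT : ∀ M, T M → φ M = m M := fun M hM => by
    rw [φd, (htT M hM).1, (htT M hM).2, m0', sub_zero]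
  have φF : ∀ M, F M → φ M = - m' M := fun M hM => by
    rw [φd, (htF M hM).1, (htF M hM).2, m0, zero_sub]
  have hi : ∀ L M N, Ses L M N → T L → φ M = φ L + φ N := by
    intro L M N h1 hL
    obtain ⟨E, h2, h3⟩ := e.pullM h1 (hs N)
    have hE := h.te h2 hL (ht N)
    obtain ⟨u1, u2⟩ := hu M _ _ h3 hE (hf N)
    rw [φT L hL, φd M, φd N, u1, u2, ha _ _ _ h2 hL (ht N)]
    ring
  have hii : ∀ L M N, Ses L M N → F N → φ M = φ L + φ N := by
    intro L M N h1 hN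
    obtain ⟨E, h2, h3⟩ := e.pushE h1 (hs L)
    have hE := h.fe h2 (hf L) hN
    obtain ⟨u1, u2⟩ := hu M _ _ h3 (ht L) hE
    rw [φF N hN, φd M, φd L, u1, u2, hb _ _ _ h2 (hf L) hN]
    ring
  refine ⟨φ, ?_, ?_, ?_⟩
  · intro L M N h1
    obtain ⟨M1, h2, h3⟩ := e.pushE h1 (hs L)
    obtain ⟨M2, h4, h5⟩ := e.pullM h2 (hs N)
    have i1 := hi _ _ _ h3 (ht L)
    have i2 := hii _ _ _ h5 (hf N)
    have i3 := hi _ _ _ (hs L) (ht L)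
    have i4 := hi _ _ _ (hs N) (ht N)
    obtain ⟨D, I, I', C, b1, b2, b3, b4⟩ := e.dia (hs M2) h4
    have hD := h.fs b3 (hf L)
    have hI := h.tq b1 (ht M2)
    have hC := h.tq b2 (ht N)
    have hI' := h.fs b4 (hf M2)
    have c1 := hc _ _ _ b1 hD (ht M2)
    have c2 := ha _ _ _ b2 hI hC
    have c3 := hb _ _ _ b3 hD hI'
    have c4 := hd _ _ _ b4 (hf M2) hC
    have d1 := φT _ (ht N)
    have d2 := φF _ (hf L)
    have d3 := φd M2
    omega
  · intro S hS
    rw [φT S hS.1, hm S Z (wT S) hS.1 ⟨h.tz, Or.inl ⟨S, hS, e.zl S, rfl⟩⟩, m0, zero_add]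
  · intro S hS
    rw [φF S hS.1, hm' S Z (wF S) hS.1 ⟨h.fz, Or.inl ⟨S, hS, e.zr S, rfl⟩⟩, m0', zero_add]

/-- every nonzero object of `T` receives a nonzero map from a simple object in `T` -/
theorem exists_simple_sub (e : Ex Z Ses) (h : TP Z Ses T F θ) :
    ∀ (n : ℕ) (M), T M → M ≠ Z → θ M ≤ n →
      ∃ B K I C, TS Z Ses T B ∧ Ses K B I ∧ Ses I M C ∧ F K := by
  intro n
  induction n with
  | zero =>
    intro M hM hz hn
    have := h.pos hM hz; omega
  | succ n ih =>
    intro M hM hz hn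
    obtain ⟨X, w, hX⟩ := exists_step (wT := fun _ => 0) (wF := fun _ => 0) e h hM hz
    have l := hX.lt h
    obtain ⟨hTX, ⟨S, hS, h1, hw⟩ | ⟨S, hS, h1, hw⟩⟩ := hX
    · by_cases hX0 : X = Z
      · subst hX0
        have := e.zl' h1
        subst this
        exact ⟨M, X, M, X, hS, e.zl M, e.zr M, h.fz⟩
      · obtain ⟨B, K, I, C, hB, h2, h3, hK⟩ := ih X hTX hX0 (by omega)
        obtain ⟨E, -, h4⟩ := e.pushE h1 h3
        exact ⟨B, K, I, E, hB, h2, h4, hK⟩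
    · by_cases hX0 : X = Z
      · subst hX0
        exact absurd (e.zm h1).2 hz
      · obtain ⟨B, K, I, C, hB, h2, h3, hK⟩ := ih X hTX hX0 (by omega)
        obtain ⟨D, J, J', C', b1, b2, b3, b4⟩ := e.dia h3 h1
        obtain ⟨E, h4, h5⟩ := e.pullM h2 b1
        exact ⟨B, E, J, C', hB, h5, b2, h.fe h4 hK (h.fs b3 hS.1)⟩

end

end BrickJH

namespace BrickJH

section
universe u
variable {O : Type u} {Z : O} {Ses : O → O → O → Prop} {T F : O → Prop} {θ : O → ℤ}

theorem TS.factor {B : O} (e : Ex Z Ses) (hB : TS Z Ses T B) {K L I C} (hL : T L)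
    (h1 : Ses K L I) (h2 : Ses I B C) (hI : I ≠ Z) : Ses K L B ∧ T K := by
  obtain ⟨hC, hK⟩ := hB.2.2 _ _ _ _ hL h1 h2 hI
  subst hC
  rw [← e.zr' h2]
  exact ⟨h1, hK⟩

/-- sign facts for additive functions with nonnegative weights -/
theorem nonneg_on_T (e : Ex Z Ses) (h : TP Z Ses T F θ) {φ : O → ℤ}
    (φa : ∀ L M N, Ses L M N → φ M = φ L + φ N) (hT : ∀ S, TS Z Ses T S → 0 ≤ φ S)
    (hF : ∀ S, FS Z Ses F S → φ S ≤ 0) :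
    ∀ (n : ℕ) (M), T M → θ M ≤ n → 0 ≤ φ M := by
  have φz : φ Z = 0 := by have := φa _ _ _ (e.zl Z); omega
  intro n
  induction n with
  | zero =>
    intro M hM hn
    by_cases hz : M = Z
    · rw [hz, φz]
    · have := h.pos hM hz; omega
  | succ n ih =>
    intro M hM hn
    by_cases hz : M = Z
    · rw [hz, φz]
    · obtain ⟨X, w, hX⟩ := exists_step (wT := fun _ => 0) (wF := fun _ => 0) e h hM hz
      have l := hX.lt h
      obtain ⟨hTX, ⟨S, hS, h1, hw⟩ | ⟨S, hS, h1, hw⟩⟩ := hX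
      · have := φa _ _ _ h1
        have := hT S hS
        have := ih X hTX (by omega)
        omega
      · have := φa _ _ _ h1
        have := hF S hS
        have := ih X hTX (by omega)
        omega

theorem nonpos_on_F (e : Ex Z Ses) (h : TP Z Ses T F θ) {φ : O → ℤ}
    (φa : ∀ L M N, Ses L M N → φ M = φ L + φ N) (hT : ∀ S, TS Z Ses T S → 0 ≤ φ S)
    (hF : ∀ S, FS Z Ses F S → φ S ≤ 0) {N} (hN : F N) : φ N ≤ 0 := by
  have := nonneg_on_T (φ := fun M => - φ M) e.op h.op
    (fun L M N a => by have := φa _ _ _ a; omega)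
    (fun S hS => by have := hF S hS; omega)
    (fun S hS => by have := hT S hS; omega) (- θ N).toNat N hN (by omega)
  omega

theorem neg_on_F (e : Ex Z Ses) (h : TP Z Ses T F θ) {φ : O → ℤ}
    (φa : ∀ L M N, Ses L M N → φ M = φ L + φ N) (hT : ∀ S, TS Z Ses T S → 0 ≤ φ S)
    (hF : ∀ S, FS Z Ses F S → φ S < 0) :
    ∀ (n : ℕ) (N), F N → N ≠ Z → - θ N ≤ n → φ N < 0 := by
  intro n
  induction n with
  | zero =>
    intro N hN hz hn
    have := h.neg hN hz; omega
  | succ n ih =>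
    intro N hN hz hn
    obtain ⟨X, w, hX⟩ := exists_step (wT := fun _ => 0) (wF := fun _ => 0) e.op h.op hN hz
    have l := hX.lt h.op
    obtain ⟨hFX, ⟨S, hS, h1, hw⟩ | ⟨S, hS, h1, hw⟩⟩ := hX
    · have := φa _ _ _ h1
      have := hF S hS
      have := nonpos_on_F e h φa hT (fun S hS => (hF S hS).le) hFX
      omega
    · have h1' : Ses N X S := h1
      have := φa _ _ _ h1'
      have := hT S hS
      have := ih X hFX (e.nz_mid_l h1' hz) (by omega)
      omega

theorem mutate (e : Ex Z Ses) (h : TP Z Ses T F θ) (θ0 : O → ℤ)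
    (add0 : ∀ L M N, Ses L M N → θ0 M = θ0 L + θ0 N) (pos0 : ∀ M, M ≠ Z → 0 < θ0 M)
    (Br : Finset O)
    (hBr : ∀ M, M ≠ Z → ∃ b ∈ Br, b ≠ Z ∧ ∃ N K, Ses b M N ∧ Ses K M b)
    {B : O} (hB : TS Z Ses T B) :
    ∃ F' θ', TP Z Ses (fun M => T M ∧ ∀ K, ¬ Ses K M B) F' θ' := by
  classical
  obtain ⟨a, aa, aT, aF⟩ := exists_additive e h (fun S => if S = B then 1 else 0) (fun _ => 0)
  obtain ⟨b, ba, bT, bF⟩ := exists_additive e h (fun S => if S = B then 0 else 1) (fun _ => 1)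
  have aT0 : ∀ S, TS Z Ses T S → 0 ≤ a S := fun S hS => by rw [aT S hS]; split_ifs <;> simp
  have bT0 : ∀ S, TS Z Ses T S → 0 ≤ b S := fun S hS => by rw [bT S hS]; split_ifs <;> simp
  have aF0 : ∀ S, FS Z Ses F S → a S ≤ 0 := fun S hS => by rw [aF S hS]; simp
  have bF0 : ∀ S, FS Z Ses F S → b S < 0 := fun S hS => by rw [bF S hS]; simp
  have aB : a B = 1 := by rw [aT B hB]; simp
  have bB : b B = 0 := by rw [bT B hB]; simp
  have apos : ∀ M, T M → 0 ≤ a M := fun M hM =>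
    nonneg_on_T e h aa aT0 aF0 (θ M).toNat M hM (by omega)
  have bpos : ∀ M, T M → 0 ≤ b M := fun M hM =>
    nonneg_on_T e h ba bT0 (fun S hS => (bF0 S hS).le) (θ M).toNat M hM (by omega)
  have bneg : ∀ N, F N → N ≠ Z → b N < 0 := fun N hN hz =>
    neg_on_F e h ba bT0 bF0 (- θ N).toNat N hN hz (by omega)
  set T' : O → Prop := fun M => T M ∧ ∀ K, ¬ Ses K M B with hT'
  have bT' : ∀ M, T' M → M ≠ Z → 0 < b M := by
    intro M hM hz
    obtain ⟨X, w, hX⟩ := exists_step (wT := fun _ => 0) (wF := fun _ => 0) e h hM.1 hz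
    obtain ⟨hTX, ⟨S, hS, h1, hw⟩ | ⟨S, hS, h1, hw⟩⟩ := hX
    · have hSB : S ≠ B := by
        rintro rfl
        exact hM.2 _ h1
      have h2 := bT S hS
      rw [if_neg hSB] at h2
      have := ba _ _ _ h1
      have := bpos X hTX
      omega
    · have := ba _ _ _ h1
      have := bF0 S hS
      have := bpos X hTX
      omega
  let F' : O → Prop := fun N => ∀ I C, Ses I N C → T' I → I = Z
  obtain ⟨c, hc0, hc⟩ : ∃ c : ℤ, 0 ≤ c ∧ ∀ x ∈ Br, |a x| < c := by
    refine ⟨1 + ∑ x ∈ Br, |a x|, ?_, ?_⟩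
    · have := Finset.sum_nonneg (s := Br) (f := fun x => |a x|) (fun x _ => abs_nonneg _)
      omega
    · intro x hx
      have := Finset.single_le_sum (s := Br) (f := fun x => |a x|) (fun x _ => abs_nonneg _) hx
      omega
  let θ' : O → ℤ := fun M => c * b M - a M
  have add' : ∀ L M N, Ses L M N → θ' M = θ' L + θ' N := by
    intro L M N hs
    change c * b M - a M = (c * b L - a L) + (c * b N - a N)
    rw [aa _ _ _ hs, ba _ _ _ hs]; ring
  have z' : θ' Z = 0 := by have := add' _ _ _ (e.zl Z); omega
  have z0 : θ0 Z = 0 := by have := add0 _ _ _ (e.zl Z); omega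
  have nn0 : ∀ M, 0 ≤ θ0 M := fun M => by
    by_cases hz : M = Z
    · rw [hz, z0]
    · exact (pos0 M hz).le
  have tq' : ∀ {L M N}, Ses L M N → T' M → T' N := by
    intro L M N hs hM
    refine ⟨h.tq hs hM.1, fun K hK => ?_⟩
    obtain ⟨E, -, h2⟩ := e.pullM hs hK
    exact hM.2 _ h2
  have te' : ∀ {L M N}, Ses L M N → T' L → T' N → T' M := by
    intro L M N hs hL hN
    refine ⟨h.te hs hL.1 hN.1, fun K hK => ?_⟩
    obtain ⟨D, I, I', C, b1, b2, b3, b4⟩ := e.dia hs hK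
    by_cases hI : I = Z
    · subst hI
      rw [← e.zl' b2] at b4
      exact hN.2 _ b4
    · exact hL.2 _ (hB.factor e hL.1 b1 b2 hI).1
  have tz' : T' Z := ⟨h.tz, fun K hK => hB.2.1 (e.zm hK).2⟩
  have fs' : ∀ {L M N}, Ses L M N → F' M → F' L := by
    intro L M N hs hM I C hI hTI
    obtain ⟨E, -, h2⟩ := e.pushE hs hI
    exact hM _ _ h2 hTI
  have pos' : ∀ (n : ℕ) (M), T' M → M ≠ Z → θ0 M ≤ n → 0 < θ' M := by
    intro n
    induction n with
    | zero => intro M hM hz hn; have := pos0 M hz; omega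
    | succ n ih =>
      intro M hM hz hn
      obtain ⟨x, hx, hx0, N, K, h1, h2⟩ := hBr M hz
      have hTx := tq' h2 hM
      have hTN := tq' h1 hM
      have e1 := add' _ _ _ h1
      have e2 := add0 _ _ _ h1
      have e3 := pos0 x hx0
      have e4 : 0 < θ' x := by
        change 0 < c * b x - a x
        have f1 := bT' x hTx hx0
        have f2 := abs_lt.mp (hc x hx)
        nlinarith
      by_cases hN : N = Z
      · rw [hN, z'] at e1; omega
      · have := ih N hTN hN (by omega)
        omega
  have negF : ∀ (n : ℕ) (M), F M → M ≠ Z → θ0 M ≤ n → θ' M < 0 := by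
    intro n
    induction n with
    | zero => intro M hM hz hn; have := pos0 M hz; omega
    | succ n ih =>
      intro M hM hz hn
      obtain ⟨x, hx, hx0, N, K, h1, h2⟩ := hBr M hz
      have hFx := h.fs h1 hM
      have hFK := h.fs h2 hM
      have e1 := add' _ _ _ h2
      have e2 := add0 _ _ _ h2
      have e3 := pos0 x hx0
      have e4 : θ' x < 0 := by
        change c * b x - a x < 0
        have f1 := bneg x hFx hx0
        have f2 := abs_lt.mp (hc x hx)
        nlinarith
      by_cases hK : K = Z
      · rw [hK, z'] at e1; omega
      · have := ih K hFK hK (by omega)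
        omega
  have filt : ∀ (n : ℕ) (M), T M → F' M → θ0 M ≤ n → b M = 0 ∧ (M ≠ Z → 0 < a M) := by
    have bz : b Z = 0 := by have := ba _ _ _ (e.zl Z); omega
    intro n
    induction n with
    | zero =>
      intro M hM hFM hn
      by_cases hz : M = Z
      · rw [hz]; exact ⟨bz, fun hh => absurd rfl hh⟩
      · have := pos0 M hz; omega
    | succ n ih =>
      intro M hM hFM hn
      by_cases hz : M = Z
      · rw [hz]; exact ⟨bz, fun hh => absurd rfl hh⟩
      · have hnT : ¬ T' M := fun hh => hz (hFM M Z (e.zr M) hh)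
        obtain ⟨K, hK⟩ : ∃ K, Ses K M B := by
          by_contra hh
          exact hnT ⟨hM, fun K hK => hh ⟨K, hK⟩⟩
        have hTK := (hB.factor e hM hK (e.zr B) hB.2.1).2
        have e1 := add0 _ _ _ hK
        have e2 := pos0 B hB.2.1
        have e3 := ih K hTK (fs' hK hFM) (by omega)
        have e4 := aa _ _ _ hK
        have e5 := ba _ _ _ hK
        have e6 := apos K hTK
        exact ⟨by omega, fun _ => by omega⟩
  refine ⟨F', θ', ?_⟩
  refine
    { tz := tz'
      fz := fun I C hI _ => (e.zm hI).1
      tq := tq'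
      fs := fs'
      te := te'
      fe := ?_
      tf := fun {M} hM hF => hF M Z (e.zr M) hM
      dec := ?_
      add := fun {L M N} hs => add' L M N hs
      pos := fun {M} hM hz => pos' (θ0 M).toNat M hM hz (by omega)
      neg := ?_ }
  · intro L M N hs hL hN I Q hI hTI
    obtain ⟨D, J, I', C, b1, b2, b3, b4⟩ := e.dia hI hs
    have hJ := hN _ _ b2 (tq' b1 hTI)
    subst hJ
    have := e.zr' b1
    subst this
    exact hL _ _ b3 hTI
  · intro M
    let P : ℕ → Prop := fun n => ∃ L N, Ses L M N ∧ T' L ∧ θ0 N = n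
    have hP : ∃ n, P n := ⟨(θ0 M).toNat, Z, M, e.zl M, tz', by have := nn0 M; omega⟩
    have hmin := fun m => @Nat.find_min P _ hP m
    obtain ⟨L, N, hs, hL, hn⟩ := Nat.find_spec hP
    refine ⟨L, N, hs, hL, ?_⟩
    intro I C hI hTI
    by_contra hI0
    obtain ⟨E, h1, h2⟩ := e.pullM hs hI
    have := add0 _ _ _ hI
    have := pos0 I hI0
    have := nn0 C
    exact hmin (θ0 C).toNat (by omega) ⟨E, C, h2, te' h1 hL hTI, by omega⟩
  · intro M hM hz
    obtain ⟨t, f, hs, ht, hf⟩ := h.dec M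
    obtain ⟨f1, f2⟩ := filt (θ0 t).toNat t ht (fs' hs hM) (by omega)
    have e1 := add' _ _ _ hs
    have e2 : t ≠ Z → θ' t < 0 := fun ht0 => by
      change c * b t - a t < 0
      rw [f1]
      have := f2 ht0
      omega
    have e3 : f ≠ Z → θ' f < 0 := fun hf0 => negF (θ0 f).toNat f hf hf0 (by omega)
    by_cases ht0 : t = Z
    · by_cases hf0 : f = Z
      · exfalso
        subst ht0 hf0
        exact hz (e.zl' hs)
      · have := e3 hf0
        rw [ht0, z'] at e1
        omega
    · have := e2 ht0
      by_cases hf0 : f = Z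
      · rw [hf0, z'] at e1; omega
      · have := e3 hf0
        omega

theorem separate_aux (e : Ex Z Ses) (θ0 : O → ℤ)
    (add0 : ∀ L M N, Ses L M N → θ0 M = θ0 L + θ0 N) (pos0 : ∀ M, M ≠ Z → 0 < θ0 M)
    (Br : Finset O)
    (hBr : ∀ M, M ≠ Z → ∃ b ∈ Br, b ≠ Z ∧ ∃ N K, Ses b M N ∧ Ses K M b)
    {X Y : O} (hX : X ≠ Z) (hY : Y ≠ Z)
    (hXY : ∀ K I C, Ses K X I → Ses I Y C → I = Z) :
    ∀ (s : Finset O) (T F : O → Prop) (θ : O → ℤ), TP Z Ses T F θ → T X →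
      (∀ b ∈ Br, T b → b ∈ s) →
      ∃ φ : O → ℤ, (∀ L M N, Ses L M N → φ M = φ L + φ N) ∧ 0 < φ X ∧ φ Y < 0 := by
  classical
  intro s
  induction s using Finset.strongInduction with
  | H s ih =>
    intro T F θ h hTX hs
    by_cases hall : ∀ B, TS Z Ses T B → ∃ K, Ses K X B
    · refine ⟨θ, fun L M N hh => h.add hh, h.pos hTX hX, ?_⟩
      obtain ⟨t, f, h1, ht, hf⟩ := h.dec Y
      by_cases ht0 : t = Z
      · subst ht0
        rw [← e.zl' h1] at hf
        exact h.neg hf hY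
      · exfalso
        obtain ⟨B, K, I, C, hB, h2, h3, hK⟩ := exists_simple_sub e h (θ t).toNat t ht ht0 (by omega)
        obtain ⟨Kx, h4⟩ := hall B hB
        obtain ⟨E, -, h5⟩ := e.pullM h4 h2
        obtain ⟨E', -, h6⟩ := e.pushE h1 h3
        have := hXY _ _ _ h5 h6
        subst this
        have := e.zr' h2
        subst this
        exact hB.2.1 (h.tf hB.1 hK)
    · push Not at hall
      obtain ⟨B, hB, hXB⟩ := hall
      obtain ⟨F', θ', h'⟩ := mutate e h θ0 add0 pos0 Br hBr hB
      have hBBr : B ∈ Br := by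
        obtain ⟨x, hx, hx0, N, K, h1, h2⟩ := hBr B hB.2.1
        have hTx := h.tq h2 hB.1
        have := (hB.2.2 Z x x N hTx (e.zl x) h1 hx0).1
        subst this
        rw [← e.zr' h1]
        exact hx
      refine ih (s.erase B) (Finset.erase_ssubset (hs B hBBr hB.1)) _ F' θ' h' ⟨hTX, hXB⟩ ?_
      intro x hx hTx
      refine Finset.mem_erase.mpr ⟨?_, hs x hx hTx.1⟩
      rintro rfl
      exact hTx.2 _ (e.zl x)

theorem separate (e : Ex Z Ses) (θ0 : O → ℤ)
    (add0 : ∀ L M N, Ses L M N → θ0 M = θ0 L + θ0 N) (pos0 : ∀ M, M ≠ Z → 0 < θ0 M)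
    (Br : Finset O)
    (hBr : ∀ M, M ≠ Z → ∃ b ∈ Br, b ≠ Z ∧ ∃ N K, Ses b M N ∧ Ses K M b)
    {X Y : O} (hX : X ≠ Z) (hY : Y ≠ Z)
    (hXY : ∀ K I C, Ses K X I → Ses I Y C → I = Z) :
    ∃ φ : O → ℤ, (∀ L M N, Ses L M N → φ M = φ L + φ N) ∧ 0 < φ X ∧ φ Y < 0 := by
  refine separate_aux e θ0 add0 pos0 Br hBr hX hY hXY Br (fun _ => True) (fun M => M = Z) θ0
    ?_ trivial (fun b hb _ => hb)
  refine
    { tz := trivial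
      fz := rfl
      tq := fun _ _ => trivial
      fs := ?_
      te := fun _ _ _ => trivial
      fe := ?_
      tf := fun _ hh => hh
      dec := fun M => ⟨M, Z, e.zr M, trivial, rfl⟩
      add := fun hs => add0 _ _ _ hs
      pos := fun _ hz => pos0 _ hz
      neg := fun hh hz => absurd hh hz }
  · rintro L M N hs rfl
    exact (e.zm hs).1
  · rintro L M N hs rfl rfl
    exact e.zl' hs

end

end BrickJH

namespace BrickJH

section concrete

theorem exists_lift {A M S C : Type} [Ring A] [AddCommGroup M] [Module A M] [AddCommGroup S]
    [Module A S] [AddCommGroup C] [Module A C] (s : M →ₗ[A] S) (hs : Surjective s)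
    (g : M →ₗ[A] C) (hg : ∀ x, s x = 0 → g x = 0) : ∃ h : S →ₗ[A] C, ∀ x, h (s x) = g x := by
  refine ⟨(LinearMap.ker s).liftQ g (fun x hx => hg x hx) ∘ₗ
    (s.quotKerEquivOfSurjective hs).symm.toLinearMap, fun x => ?_⟩
  have : (s.quotKerEquivOfSurjective hs).symm (s x) = Submodule.Quotient.mk x := by
    rw [LinearEquiv.symm_apply_eq]; rfl
  rw [LinearMap.comp_apply, LinearEquiv.coe_coe, this]
  rfl

theorem exists_colift {A M S C : Type} [Ring A] [AddCommGroup M] [Module A M] [AddCommGroup S]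
    [Module A S] [AddCommGroup C] [Module A C] (j : S →ₗ[A] M) (hj : Injective j)
    (g : C →ₗ[A] M) (hg : ∀ x, ∃ y, j y = g x) : ∃ h : C →ₗ[A] S, ∀ x, j (h x) = g x := by
  refine ⟨(LinearEquiv.ofInjective j hj).symm.toLinearMap ∘ₗ
    g.codRestrict (LinearMap.range j) (fun x => hg x), fun x => ?_⟩
  have := (LinearEquiv.ofInjective j hj).apply_symm_apply
    (g.codRestrict (LinearMap.range j) (fun x => hg x) x)
  exact congrArg Subtype.val this

def IsSes (A L M N : Type) [Ring A] [AddCommGroup L] [Module A L] [AddCommGroup M]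
    [Module A M] [AddCommGroup N] [Module A N] : Prop :=
  ∃ (i : L →ₗ[A] M) (p : M →ₗ[A] N), Injective i ∧ Surjective p ∧ (∀ x, p (i x) = 0) ∧
    ∀ y, p y = 0 → ∃ x, i x = y

variable (A : Type) [Ring A]

/-- finitely generated modules -/
def FM : Type 1 := {M : ModuleCat.{0} A // Module.Finite A M}

instance fmSetoid : Setoid (FM A) where
  r M N := Nonempty (M.1 ≃ₗ[A] N.1)
  iseqv := ⟨fun _ => ⟨LinearEquiv.refl _ _⟩, fun ⟨f⟩ => ⟨f.symm⟩, fun ⟨f⟩ ⟨g⟩ => ⟨f.trans g⟩⟩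

/-- isomorphism classes of finitely generated modules -/
def Ob : Type 1 := Quotient (fmSetoid A)

def cl (M : Type) [AddCommGroup M] [Module A M] [h : Module.Finite A M] : Ob A :=
  Quotient.mk (fmSetoid A) ⟨ModuleCat.of A M, h⟩

theorem Ob.ind' {P : Ob A → Prop}
    (h : ∀ (M : Type) [AddCommGroup M] [Module A M] [Module.Finite A M], P (cl A M)) (x : Ob A) :
    P x := by
  induction x using Quotient.ind with
  | _ M =>
    have := M.2
    exact h M.1

variable {A}

theorem cl_eq {M N : Type} [AddCommGroup M] [Module A M] [Module.Finite A M]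
    [AddCommGroup N] [Module A N] [Module.Finite A N] :
    cl A M = cl A N ↔ Nonempty (M ≃ₗ[A] N) := by
  exact ⟨fun h => Quotient.exact h, fun h => Quotient.sound h⟩

variable (A) in
def SesO (x y z : Ob A) : Prop :=
  ∃ L M N : FM A, Quotient.mk (fmSetoid A) L = x ∧ Quotient.mk (fmSetoid A) M = y ∧
    Quotient.mk (fmSetoid A) N = z ∧ IsSes A L.1 M.1 N.1

theorem ses_cl {L M N : Type} [AddCommGroup L] [Module A L] [Module.Finite A L]
    [AddCommGroup M] [Module A M] [Module.Finite A M]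
    [AddCommGroup N] [Module A N] [Module.Finite A N] :
    SesO A (cl A L) (cl A M) (cl A N) ↔ IsSes A L M N := by
  constructor
  · rintro ⟨L', M', N', h1, h2, h3, i, p, hi, hp, h0, h⟩
    obtain ⟨e1⟩ : Nonempty (L'.1 ≃ₗ[A] L) := Quotient.exact h1
    obtain ⟨e2⟩ : Nonempty (M'.1 ≃ₗ[A] M) := Quotient.exact h2
    obtain ⟨e3⟩ : Nonempty (N'.1 ≃ₗ[A] N) := Quotient.exact h3
    refine ⟨e2.toLinearMap ∘ₗ i ∘ₗ e1.symm.toLinearMap,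
      e3.toLinearMap ∘ₗ p ∘ₗ e2.symm.toLinearMap, ?_, ?_, ?_, ?_⟩
    · exact e2.injective.comp (hi.comp e1.symm.injective)
    · exact e3.surjective.comp (hp.comp e2.symm.surjective)
    · intro x; simp [h0]
    · intro y hy
      have : p (e2.symm y) = 0 := by simpa using hy
      obtain ⟨x, hx⟩ := h _ this
      exact ⟨e1 x, by simp [hx]⟩
  · intro h
    exact ⟨⟨ModuleCat.of A L, ‹_›⟩, ⟨ModuleCat.of A M, ‹_›⟩, ⟨ModuleCat.of A N, ‹_›⟩,
      rfl, rfl, rfl, h⟩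

theorem cl_zero {M : Type} [AddCommGroup M] [Module A M] [Module.Finite A M] :
    cl A M = cl A PUnit ↔ Subsingleton M := by
  rw [cl_eq]
  constructor
  · rintro ⟨e⟩
    exact e.toEquiv.subsingleton
  · intro h
    exact ⟨LinearEquiv.ofSubsingleton _ _⟩

theorem exO [IsNoetherianRing A] : Ex (cl A PUnit) (SesO A) where
  zl := by
    refine Ob.ind' A ?_
    intro M _ _ _
    rw [ses_cl]
    exact ⟨0, LinearMap.id, injective_of_subsingleton _, surjective_id, by simp,
      fun y hy => ⟨0, by simpa using hy.symm⟩⟩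
  zr := by
    refine Ob.ind' A ?_
    intro M _ _ _
    rw [ses_cl]
    exact ⟨LinearMap.id, 0, injective_id, surjective_to_subsingleton _, by simp,
      fun y hy => ⟨y, rfl⟩⟩
  zl' := by
    intro M N
    induction M using Ob.ind'
    induction N using Ob.ind'
    rw [ses_cl, cl_eq]
    rintro ⟨i, p, hi, hp, h0, h⟩
    refine ⟨LinearEquiv.ofBijective p ⟨?_, hp⟩⟩
    rw [injective_iff_map_eq_zero]
    intro y hy
    obtain ⟨x, rfl⟩ := h y hy
    rw [Subsingleton.elim x 0, map_zero]
  zr' := by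
    intro M N
    induction M using Ob.ind'
    induction N using Ob.ind'
    rw [ses_cl, cl_eq]
    rintro ⟨i, p, hi, hp, h0, h⟩
    exact ⟨LinearEquiv.ofBijective i ⟨hi, fun y => h y (Subsingleton.elim _ _)⟩⟩
  zm := by
    intro M N
    induction M using Ob.ind'
    induction N using Ob.ind'
    rw [ses_cl, cl_zero, cl_zero]
    rintro ⟨i, p, hi, hp, h0, h⟩
    exact ⟨hi.subsingleton, hp.subsingleton⟩
  pullM := by
    intro N E M Q R
    induction N using Ob.ind' with | _ N
    induction E using Ob.ind' with | _ E
    induction M using Ob.ind' with | _ M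
    induction Q using Ob.ind' with | _ Q
    induction R using Ob.ind' with | _ R
    rw [ses_cl, ses_cl]
    rintro ⟨i, p, hi, hp, h0, h⟩ ⟨j, r, hj, hr, h0', h'⟩
    refine ⟨cl A (LinearMap.ker (r ∘ₗ p)), ?_, ?_⟩
    · rw [ses_cl]
      obtain ⟨g, hg⟩ := exists_colift j hj (p ∘ₗ (LinearMap.ker (r ∘ₗ p)).subtype)
        (fun x => h' _ x.2)
      refine ⟨i.codRestrict _ (fun x => by simp [h0]), g, ?_, ?_, ?_, ?_⟩
      · intro x y hxy
        exact hi (congrArg Subtype.val hxy)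
      · intro q
        obtain ⟨x, hx⟩ := hp (j q)
        refine ⟨⟨x, by simp [hx, h0']⟩, hj ?_⟩
        rw [hg]; exact hx
      · intro x
        apply hj
        exact (hg _).trans ((h0 x).trans (map_zero j).symm)
      · intro y hy
        have := hg y
        rw [hy, map_zero] at this
        obtain ⟨x, hx⟩ := h y.1 this.symm
        exact ⟨x, Subtype.ext hx⟩
    · rw [ses_cl]
      exact ⟨Submodule.subtype _, r ∘ₗ p, Subtype.val_injective, hr.comp hp,
        fun x => x.2, fun y hy => ⟨⟨y, hy⟩, rfl⟩⟩
  pushE := by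
    intro N E M K I
    induction N using Ob.ind' with | _ N
    induction E using Ob.ind' with | _ E
    induction M using Ob.ind' with | _ M
    induction K using Ob.ind' with | _ K
    induction I using Ob.ind' with | _ I
    rw [ses_cl, ses_cl]
    rintro ⟨i, p, hi, hp, h0, h⟩ ⟨j, r, hj, hr, h0', h'⟩
    refine ⟨cl A (E ⧸ LinearMap.range (i ∘ₗ j)), ?_, ?_⟩
    · rw [ses_cl]
      obtain ⟨f, hf⟩ := exists_lift r hr ((LinearMap.range (i ∘ₗ j)).mkQ ∘ₗ i) (by
        intro x hx
        obtain ⟨k, rfl⟩ := h' x hx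
        simp only [LinearMap.comp_apply, Submodule.mkQ_apply, Submodule.Quotient.mk_eq_zero]
        exact ⟨k, rfl⟩)
      obtain ⟨g, hg⟩ := exists_lift (LinearMap.range (i ∘ₗ j)).mkQ (Submodule.mkQ_surjective _) p
        (by
          intro x hx
          simp only [Submodule.mkQ_apply, Submodule.Quotient.mk_eq_zero] at hx
          obtain ⟨k, rfl⟩ := hx
          exact h0 _)
      refine ⟨f, g, ?_, ?_, ?_, ?_⟩
      · rw [injective_iff_map_eq_zero]
        intro x hx
        obtain ⟨x, rfl⟩ := hr x
        rw [hf] at hx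
        simp only [LinearMap.comp_apply, Submodule.mkQ_apply, Submodule.Quotient.mk_eq_zero] at hx
        obtain ⟨k, hk⟩ := hx
        rw [← hi hk, h0']
      · intro m
        obtain ⟨x, rfl⟩ := hp m
        exact ⟨_, hg x⟩
      · intro x
        obtain ⟨x, rfl⟩ := hr x
        rw [hf, LinearMap.comp_apply, hg, h0]
      · intro y hy
        obtain ⟨y, rfl⟩ := Submodule.mkQ_surjective _ y
        rw [hg] at hy
        obtain ⟨x, rfl⟩ := h y hy
        exact ⟨r x, hf x⟩
    · rw [ses_cl]
      refine ⟨i ∘ₗ j, Submodule.mkQ _, hi.comp hj, Submodule.mkQ_surjective _, ?_, ?_⟩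
      · intro x
        simp only [Submodule.mkQ_apply, Submodule.Quotient.mk_eq_zero]
        exact ⟨x, rfl⟩
      · intro y hy
        exact (Submodule.Quotient.mk_eq_zero _).1 hy
  pullE := by
    intro N E M K Q
    induction N using Ob.ind' with | _ N
    induction E using Ob.ind' with | _ E
    induction M using Ob.ind' with | _ M
    induction K using Ob.ind' with | _ K
    induction Q using Ob.ind' with | _ Q
    rw [ses_cl, ses_cl]
    rintro ⟨i, p, hi, hp, h0, h⟩ ⟨j, r, hj, hr, h0', h'⟩
    let W : Submodule A (E × Q) :=
      LinearMap.ker (p ∘ₗ LinearMap.fst A E Q - r ∘ₗ LinearMap.snd A E Q)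
    have hW : ∀ x : E × Q, x ∈ W ↔ p x.1 = r x.2 := fun x => by
      simp [W, LinearMap.mem_ker, sub_eq_zero]
    refine ⟨cl A W, ?_, ?_⟩
    · rw [ses_cl]
      refine ⟨(LinearMap.inl A E Q ∘ₗ i).codRestrict W (fun x => by simp [hW, h0]),
        LinearMap.snd A E Q ∘ₗ W.subtype, ?_, ?_, ?_, ?_⟩
      · intro x y hxy
        have := congrArg (fun z => z.1.1) hxy
        exact hi this
      · intro q
        obtain ⟨x, hx⟩ := hp (r q)
        exact ⟨⟨(x, q), (hW _).2 hx⟩, rfl⟩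
      · intro x; rfl
      · rintro ⟨⟨x, q⟩, hxq⟩ hy
        change q = 0 at hy
        subst hy
        have := (hW _).1 hxq
        simp only [map_zero] at this
        obtain ⟨n, rfl⟩ := h x this
        exact ⟨n, rfl⟩
    · rw [ses_cl]
      refine ⟨(LinearMap.inr A E Q ∘ₗ j).codRestrict W (fun x => by simp [hW, h0']),
        LinearMap.fst A E Q ∘ₗ W.subtype, ?_, ?_, ?_, ?_⟩
      · intro x y hxy
        have := congrArg (fun z => z.1.2) hxy
        exact hj this
      · intro q
        obtain ⟨x, hx⟩ := hr (p q)
        exact ⟨⟨(q, x), (hW _).2 hx.symm⟩, rfl⟩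
      · intro x; rfl
      · rintro ⟨⟨x, q⟩, hxq⟩ hy
        change x = 0 at hy
        subst hy
        have := (hW _).1 hxq
        simp only [map_zero] at this
        obtain ⟨n, rfl⟩ := h' q this.symm
        exact ⟨n, rfl⟩
  pushM := by
    intro N E M N' R
    induction N using Ob.ind' with | _ N
    induction E using Ob.ind' with | _ E
    induction M using Ob.ind' with | _ M
    induction N' using Ob.ind' with | _ Q
    induction R using Ob.ind' with | _ R
    rw [ses_cl, ses_cl]
    rintro ⟨i, p, hi, hp, h0, h⟩ ⟨j, r, hj, hr, h0', h'⟩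
    let W : Submodule A (E × Q) := LinearMap.range (i.prod (-j))
    have hW : ∀ x : E × Q, W.mkQ x = 0 ↔ ∃ n, i n = x.1 ∧ - j n = x.2 := fun x => by
      simp only [Submodule.mkQ_apply, Submodule.Quotient.mk_eq_zero, W, LinearMap.mem_range]
      constructor
      · rintro ⟨n, rfl⟩; exact ⟨n, rfl, rfl⟩
      · rintro ⟨n, h1, h2⟩; exact ⟨n, Prod.ext h1 h2⟩
    refine ⟨cl A ((E × Q) ⧸ W), ?_, ?_⟩
    · rw [ses_cl]
      obtain ⟨g, hg⟩ := exists_lift W.mkQ (Submodule.mkQ_surjective _) (p ∘ₗ LinearMap.fst A E Q)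
        (by
          intro x hx
          obtain ⟨n, h1, h2⟩ := (hW x).1 hx
          simp [← h1, h0])
      refine ⟨W.mkQ ∘ₗ LinearMap.inr A E Q, g, ?_, ?_, ?_, ?_⟩
      · rw [injective_iff_map_eq_zero]
        intro x hx
        obtain ⟨n, h1, h2⟩ := (hW _).1 hx
        have : n = 0 := hi (by rw [h1, map_zero]; rfl)
        subst this
        simpa using h2.symm
      · intro m
        obtain ⟨x, rfl⟩ := hp m
        exact ⟨W.mkQ (x, 0), hg _⟩
      · intro x
        rw [LinearMap.comp_apply, hg]
        simp
      · intro y hy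
        obtain ⟨⟨x, q⟩, rfl⟩ := Submodule.mkQ_surjective _ y
        rw [hg] at hy
        obtain ⟨n, rfl⟩ := h x hy
        refine ⟨q + j n, ?_⟩
        rw [LinearMap.comp_apply, ← sub_eq_zero, ← map_sub, hW]
        exact ⟨-n, by simp, by simp⟩
    · rw [ses_cl]
      obtain ⟨g, hg⟩ := exists_lift W.mkQ (Submodule.mkQ_surjective _) (r ∘ₗ LinearMap.snd A E Q)
        (by
          intro x hx
          obtain ⟨n, h1, h2⟩ := (hW x).1 hx
          simp [← h2, h0'])
      refine ⟨W.mkQ ∘ₗ LinearMap.inl A E Q, g, ?_, ?_, ?_, ?_⟩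
      · rw [injective_iff_map_eq_zero]
        intro x hx
        obtain ⟨n, h1, h2⟩ := (hW _).1 hx
        have : n = 0 := hj (by rw [map_zero, ← neg_eq_zero, h2]; rfl)
        subst this
        simpa using h1.symm
      · intro m
        obtain ⟨x, rfl⟩ := hr m
        exact ⟨W.mkQ (0, x), hg _⟩
      · intro x
        rw [LinearMap.comp_apply, hg]
        simp
      · intro y hy
        obtain ⟨⟨x, q⟩, rfl⟩ := Submodule.mkQ_surjective _ y
        rw [hg] at hy
        obtain ⟨n, rfl⟩ := h' q hy
        refine ⟨x + i n, ?_⟩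
        rw [LinearMap.comp_apply, ← sub_eq_zero, ← map_sub, hW]
        exact ⟨n, by simp, by simp⟩
  dia := by
    intro M K1 S1 K2 S2
    induction M using Ob.ind' with | _ M
    induction K1 using Ob.ind' with | _ K1
    induction S1 using Ob.ind' with | _ S1
    induction K2 using Ob.ind' with | _ K2
    induction S2 using Ob.ind' with | _ S2
    rw [ses_cl, ses_cl]
    rintro ⟨i, p, hi, hp, h0, h⟩ ⟨j, r, hj, hr, h0', h'⟩
    let I := LinearMap.range (r ∘ₗ i)
    let I' := LinearMap.range (p ∘ₗ j)
    refine ⟨cl A (LinearMap.ker (r ∘ₗ i)), cl A I, cl A I', cl A (S2 ⧸ I), ?_, ?_, ?_, ?_⟩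
    · rw [ses_cl]
      refine ⟨Submodule.subtype _, (r ∘ₗ i).rangeRestrict, Subtype.val_injective,
        LinearMap.surjective_rangeRestrict _, ?_, ?_⟩
      · intro x; exact Subtype.ext x.2
      · intro y hy; exact ⟨⟨y, congrArg Subtype.val hy⟩, rfl⟩
    · rw [ses_cl]
      refine ⟨Submodule.subtype _, Submodule.mkQ _, Subtype.val_injective,
        Submodule.mkQ_surjective _, ?_, ?_⟩
      · intro x; simp
      · intro y hy
        simp only [Submodule.mkQ_apply, Submodule.Quotient.mk_eq_zero] at hy
        exact ⟨⟨y, hy⟩, rfl⟩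
    · rw [ses_cl]
      obtain ⟨g, hg⟩ := exists_colift j hj (i ∘ₗ (LinearMap.ker (r ∘ₗ i)).subtype)
        (fun x => h' _ x.2)
      refine ⟨g, (p ∘ₗ j).rangeRestrict, ?_, LinearMap.surjective_rangeRestrict _, ?_, ?_⟩
      · intro x y hxy
        have := congrArg j hxy
        rw [hg, hg] at this
        exact Subtype.ext (hi this)
      · intro x
        apply Subtype.ext
        change p (j (g x)) = 0
        rw [hg]
        exact h0 _
      · intro y hy
        have hy' : p (j y) = 0 := congrArg Subtype.val hy
        obtain ⟨x, hx⟩ := h _ hy'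
        refine ⟨⟨x, ?_⟩, hj ?_⟩
        · change r (i x) = 0
          rw [hx, h0']
        · rw [hg]; exact hx
    · rw [ses_cl]
      obtain ⟨g, hg⟩ := exists_lift p hp (I.mkQ ∘ₗ r) (by
        intro x hx
        obtain ⟨k, rfl⟩ := h x hx
        simp only [LinearMap.comp_apply, Submodule.mkQ_apply, Submodule.Quotient.mk_eq_zero]
        exact ⟨k, rfl⟩)
      refine ⟨Submodule.subtype _, g, Subtype.val_injective, ?_, ?_, ?_⟩
      · intro y
        obtain ⟨y, rfl⟩ := Submodule.mkQ_surjective _ y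
        obtain ⟨y, rfl⟩ := hr y
        exact ⟨p y, hg y⟩
      · rintro ⟨x, k, rfl⟩
        change g (p (j k)) = 0
        rw [hg, LinearMap.comp_apply, h0', map_zero]
      · intro y hy
        obtain ⟨y, rfl⟩ := hp y
        rw [hg] at hy
        simp only [LinearMap.comp_apply, Submodule.mkQ_apply, Submodule.Quotient.mk_eq_zero] at hy
        obtain ⟨k, hk⟩ := hy
        have : r (y - i k) = 0 := by
          rw [map_sub, ← hk]; simp
        obtain ⟨l, hl⟩ := h' _ this
        refine ⟨⟨p y, l, ?_⟩, rfl⟩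
        change p (j l) = p y
        rw [hl, map_sub, h0, sub_zero]

variable (A) in
noncomputable def len (x : Ob A) : ℤ :=
  Quotient.lift (fun M : FM A => ((Module.length A M.1).toNat : ℤ))
    (fun M N h => by
      obtain ⟨e⟩ : Nonempty (M.1 ≃ₗ[A] N.1) := h
      simp only [e.length_eq]) x

theorem len_cl {M : Type} [AddCommGroup M] [Module A M] [Module.Finite A M] :
    len A (cl A M) = ((Module.length A M).toNat : ℤ) := rfl

theorem len_add [IsArtinianRing A] (x y z : Ob A) (h : SesO A x y z) :
    len A y = len A x + len A z := by
  induction x using Ob.ind' with | _ L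
  induction y using Ob.ind' with | _ M
  induction z using Ob.ind' with | _ N
  rw [ses_cl] at h
  obtain ⟨i, p, hi, hp, h0, h⟩ := h
  have hex : Function.Exact i p := fun y => ⟨h y, by rintro ⟨x, rfl⟩; exact h0 x⟩
  rw [len_cl, len_cl, len_cl, Module.length_eq_add_of_exact i p hi hp hex,
    ENat.toNat_add Module.length_ne_top Module.length_ne_top, Nat.cast_add]

theorem len_pos [IsArtinianRing A] (x : Ob A) (h : x ≠ cl A PUnit) : 0 < len A x := by
  induction x using Ob.ind' with | _ L
  rw [Ne, cl_zero, not_subsingleton_iff_nontrivial] at h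
  rw [len_cl]
  have h1 : Module.length A L ≠ 0 := Module.length_pos.ne'
  have h2 : Module.length A L ≠ ⊤ := Module.length_ne_top
  have : (Module.length A L).toNat ≠ 0 := by
    rw [Ne, ENat.toNat_eq_zero]; tauto
  omega

theorem exists_brick [IsArtinianRing A] : ∀ (n : ℕ) (M : ModuleCat.{0} A), Module.Finite A M →
    Nontrivial M → (Module.length A M).toNat ≤ n →
    ∃ b : ModuleCat.{0} A, Module.Finite A b ∧ IsBrick A b ∧
      (∃ i : b →ₗ[A] M, Injective i) ∧ ∃ p : M →ₗ[A] b, Surjective p := by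
  intro n
  induction n with
  | zero =>
    intro M hM hn hl
    have := len_pos (cl A M) (by rwa [Ne, cl_zero, not_subsingleton_iff_nontrivial])
    rw [len_cl] at this
    omega
  | succ n ih =>
    intro M hM hn hl
    by_cases hb : IsBrick A M
    · exact ⟨M, hM, hb, ⟨LinearMap.id, injective_id⟩, LinearMap.id, surjective_id⟩
    · have : ∃ f : M →ₗ[A] M, f ≠ 0 ∧ ¬ Bijective f := by
        by_contra hh
        push Not at hh
        exact hb ⟨hn, hh⟩
      obtain ⟨f, hf, hfb⟩ := this
      have hinj : ¬ Injective f := fun hi =>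
        hfb (IsArtinian.bijective_of_injective_endomorphism f hi)
      have hker : Nontrivial (LinearMap.ker f) := by
        rw [Submodule.nontrivial_iff_ne_bot, Ne, LinearMap.ker_eq_bot]
        exact hinj
      have hran : Nontrivial (LinearMap.range f) := by
        rw [Submodule.nontrivial_iff_ne_bot, Ne, LinearMap.range_eq_bot]
        exact hf
      have hs : SesO A (cl A (LinearMap.ker f)) (cl A M) (cl A (LinearMap.range f)) := by
        rw [ses_cl]
        refine ⟨Submodule.subtype _, f.rangeRestrict, Subtype.val_injective,
          LinearMap.surjective_rangeRestrict _, ?_, ?_⟩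
        · intro x; exact Subtype.ext x.2
        · intro y hy; exact ⟨⟨y, congrArg Subtype.val hy⟩, rfl⟩
      have h1 := len_add _ _ _ hs
      have h2 := len_pos (cl A (LinearMap.ker f))
        (by rwa [Ne, cl_zero, not_subsingleton_iff_nontrivial])
      rw [len_cl, len_cl] at h1
      rw [len_cl] at h1 h2
      obtain ⟨b, hb1, hb2, ⟨i, hi⟩, p, hp⟩ :=
        ih (ModuleCat.of A (LinearMap.range f)) (inferInstanceAs (Module.Finite A (LinearMap.range f)))
          hran (by
            change (Module.length A (LinearMap.range f)).toNat ≤ n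
            omega)
      exact ⟨b, hb1, hb2, ⟨(LinearMap.range f).subtype ∘ₗ i, Subtype.val_injective.comp hi⟩,
        p ∘ₗ f.rangeRestrict, hp.comp (LinearMap.surjective_rangeRestrict _)⟩

theorem exists_Br [IsArtinianRing A] (hbf : BrickFinite A) :
    ∃ Br : Finset (Ob A), ∀ M, M ≠ cl A PUnit → ∃ b ∈ Br, b ≠ cl A PUnit ∧
      ∃ N K, SesO A b M N ∧ SesO A K M b := by
  classical
  obtain ⟨n, B, hB⟩ := hbf
  refine ⟨Finset.univ.image (fun i =>
    if h : Module.Finite A (B i) then cl A (B i) else cl A PUnit), ?_⟩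
  intro M
  induction M using Ob.ind' with | _ M
  intro hM
  rw [Ne, cl_zero, not_subsingleton_iff_nontrivial] at hM
  obtain ⟨b, hb, hbb, ⟨i, hi⟩, p, hp⟩ := exists_brick _ (ModuleCat.of A M)
    (inferInstanceAs (Module.Finite A M)) hM le_rfl
  change b →ₗ[A] M at i
  change M →ₗ[A] b at p
  obtain ⟨l, ⟨e⟩⟩ := hB b hb hbb
  have hfl : Module.Finite A (B l) := Module.Finite.equiv e
  have hcl : cl A b = cl A (B l) := cl_eq.2 ⟨e⟩
  refine ⟨cl A b, ?_, ?_, cl A (M ⧸ LinearMap.range i), cl A (LinearMap.ker p), ?_, ?_⟩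
  · rw [Finset.mem_image]
    exact ⟨l, Finset.mem_univ _, by rw [dif_pos hfl, hcl]⟩
  · rw [Ne, cl_zero, not_subsingleton_iff_nontrivial]
    exact hbb.1
  · rw [ses_cl]
    refine ⟨i, Submodule.mkQ _, hi, Submodule.mkQ_surjective _, ?_, ?_⟩
    · intro x; simp
    · intro y hy
      exact (Submodule.Quotient.mk_eq_zero _).1 hy
  · rw [ses_cl]
    exact ⟨Submodule.subtype _, p, Subtype.val_injective, hp, fun x => x.2,
      fun y hy => ⟨⟨y, hy⟩, rfl⟩⟩

theorem main_sep [IsArtinianRing A] (hbf : BrickFinite A) (X Y : ModuleCat.{0} A)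
    (hX : Module.Finite A X) (bX : IsBrick A X) (hY : Module.Finite A Y) (bY : IsBrick A Y)
    (hXY : ∀ f : X →ₗ[A] Y, f = 0) : ∃ θ : AddInvariant A, θ.val X ≠ θ.val Y := by
  classical
  obtain ⟨Br, hBr⟩ := exists_Br hbf
  have nX : cl A X ≠ cl A PUnit := by
    rw [Ne, cl_zero, not_subsingleton_iff_nontrivial]; exact bX.1
  have nY : cl A Y ≠ cl A PUnit := by
    rw [Ne, cl_zero, not_subsingleton_iff_nontrivial]; exact bY.1
  obtain ⟨φ, φa, φX, φY⟩ := separate (exO (A := A)) (len A) len_add len_pos Br hBr nX nY (by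
    intro K I C h1 h2
    induction K using Ob.ind' with | _ K
    induction I using Ob.ind' with | _ I
    induction C using Ob.ind' with | _ C
    rw [ses_cl] at h1 h2
    obtain ⟨i, p, hi, hp, h0, h⟩ := h1
    obtain ⟨j, r, hj, hr, h0', h'⟩ := h2
    rw [cl_zero]
    have := hXY (j ∘ₗ p)
    refine subsingleton_of_forall_eq 0 (fun x => ?_)
    obtain ⟨x, rfl⟩ := hp x
    apply hj
    rw [map_zero]
    exact LinearMap.congr_fun this x)
  refine ⟨⟨fun M => if h : Module.Finite A M then (φ (cl A M) : ℝ) else 0, ?_, ?_⟩, ?_⟩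
  · intro M N e
    by_cases hM : Module.Finite A M
    · have hN : Module.Finite A N := Module.Finite.equiv e
      simp only [dif_pos hM, dif_pos hN]
      rw [cl_eq.2 ⟨e⟩]
    · have hN : ¬ Module.Finite A N := fun hN => hM (Module.Finite.equiv e.symm)
      simp only [dif_neg hM, dif_neg hN]
  · intro L M N i p hM hi hp hex
    have hL : Module.Finite A L := Module.Finite.of_injective i hi
    have hN : Module.Finite A N := Module.Finite.of_surjective p hp
    simp only [dif_pos hM, dif_pos hN, dif_pos hL]
    have := φa (cl A L) (cl A M) (cl A N) (by
      rw [ses_cl]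
      exact ⟨i, p, hi, hp, fun x => (hex _).2 ⟨x, rfl⟩, fun y hy => (hex y).1 hy⟩)
    exact_mod_cast this
  · simp only [dif_pos hX, dif_pos hY]
    intro hh
    have : φ (cl A X) = φ (cl A Y) := by exact_mod_cast hh
    omega

def cycX (X Y : ModuleCat.{0} A) : ℕ → ModuleCat.{0} A
  | 0 => X
  | 1 => Y
  | _ + 2 => X

def cycF (X Y : ModuleCat.{0} A) (f : X →ₗ[A] Y) (g : Y →ₗ[A] X) :
    ∀ i, cycX X Y i →ₗ[A] cycX X Y (i + 1)
  | 0 => f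
  | 1 => g
  | _ + 2 => (0 : X →ₗ[A] X)

end concrete

end BrickJH

theorem stmt19 (k A : Type) [Field k] [Ring A] [Algebra k A] [FiniteDimensional k A]
    (hbf : BrickFinite A) (hbd : BrickDirected A) :
    ∀ X Y : ModuleCat.{0} A,
      Module.Finite A X → IsBrick A X → Module.Finite A Y → IsBrick A Y →
      ¬ Nonempty (X ≃ₗ[A] Y) →
      ∃ θ : AddInvariant A, θ.val X ≠ θ.val Y := by
  intro X Y hX bX hY bY hXY
  have hart : IsArtinianRing A := IsArtinianRing.of_finite k A
  by_cases h1 : ∀ f : X →ₗ[A] Y, f = 0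
  · exact BrickJH.main_sep hbf X Y hX bX hY bY h1
  by_cases h2 : ∀ f : Y →ₗ[A] X, f = 0
  · obtain ⟨θ, hθ⟩ := BrickJH.main_sep hbf Y X hY bY hX bX h2
    exact ⟨θ, hθ.symm⟩
  exfalso
  push Not at h1 h2
  obtain ⟨f, hf⟩ := h1
  obtain ⟨g, hg⟩ := h2
  apply hbd
  refine ⟨2, BrickJH.cycX X Y, BrickJH.cycF X Y f g, by norm_num, ?_, ?_,
    ⟨LinearEquiv.refl A X⟩⟩
  · intro i hi
    interval_cases i
    · exact ⟨hX, bX⟩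
    · exact ⟨hY, bY⟩
    · exact ⟨hX, bX⟩
  · intro i hi
    interval_cases i
    · exact ⟨hf, fun hb => hXY ⟨LinearEquiv.ofBijective f hb⟩⟩
    · exact ⟨hg, fun hb => hXY ⟨(LinearEquiv.ofBijective g hb).symm⟩⟩
end
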